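/- Let n ≥ 1, α ∈ (0,1), and let J : ℝ^{2n} → End(ℝ^{2n}) be bounded and α-Hölder with J(x) ∘ J(x) = −id for all x. Let u : D \ {0} → ℝ^{2n} be differentiable with ∂u/∂x + J(u) ∂u/∂y = 0, bounded, and of finite energy ∫_{D \ {0}} ‖du‖² dA < ∞. Then u extends to a continuous map on all of D. (Removal of interior point singularities, part 1 of Theorem 2.7, in a coordinate chart.) -/

import Mathlib

open MeasureTheory

section Stokes

variable {V : Type*} [NormedAddCommGroup V] [NormedSpace ℝ V]

theorem sq_lintegral_le_measure_mul_lintegral_sq {X : Type*} [MeasurableSpace X] (μ : Measure X)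
    {f : X → ENNReal} (hf : AEMeasurable f μ) :
    (∫⁻ x, f x ∂μ) ^ 2 ≤ μ Set.univ * ∫⁻ x, f x ^ 2 ∂μ := by
  have h := ENNReal.lintegral_mul_le_Lp_mul_Lq μ Real.HolderConjugate.two_two
    (aemeasurable_const (b := (1 : ENNReal))) hf
  simp only [Pi.mul_apply, one_mul, ENNReal.one_rpow, lintegral_one] at h
  calc (∫⁻ x, f x ∂μ) ^ 2 ≤ _ := pow_le_pow_left' h 2
    _ = _ := by
      rw [mul_pow, ← ENNReal.rpow_natCast, ← ENNReal.rpow_natCast, ← ENNReal.rpow_mul,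
        ← ENNReal.rpow_mul]
      norm_num

theorem enorm_sub_sq_le_lintegral_deriv [CompleteSpace V] {f f' : ℝ → V} {a b : ℝ} (hab : a ≤ b)
    (hf : ∀ t ∈ Set.Icc a b, HasDerivAt f (f' t) t) (hf' : AEStronglyMeasurable f' volume) :
    ‖f b - f a‖ₑ ^ 2 ≤ ENNReal.ofReal (b - a) * ∫⁻ t in Set.Ioc a b, ‖f' t‖ₑ ^ 2 := by
  have hsq := sq_lintegral_le_measure_mul_lintegral_sq (volume.restrict (Set.Ioc a b))
    (f := fun t => ‖f' t‖ₑ) hf'.restrict.enorm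
  rw [Measure.restrict_apply_univ, Real.volume_Ioc] at hsq
  refine le_trans ?_ hsq
  gcongr
  by_cases htop : ∫⁻ t in Set.Ioc a b, ‖f' t‖ₑ = ⊤
  · simp [htop]
  · have hInt : IntegrableOn f' (Set.Ioc a b) := ⟨hf'.restrict, lt_top_iff_ne_top.2 htop⟩
    rw [← intervalIntegral.integral_eq_sub_of_hasDerivAt (f' := f')
      (by rwa [Set.uIcc_of_le hab]) ((intervalIntegrable_iff_integrableOn_Ioc_of_le hab).2 hInt),
      intervalIntegral.integral_of_le hab]
    exact enorm_integral_le_lintegral_enorm _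

theorem integrable_bilin_of_memLp_two (ω : V →L[ℝ] V →L[ℝ] ℝ) {f g : ℂ → V} (hf : MemLp f 2)
    (hg : MemLp g 2) : Integrable fun z => ω (f z) (g z) := by
  refine memLp_one_iff_integrable.1 (MemLp.of_bilin (p := 2) (q := 2) (fun a b => ω a b) ‖ω‖₊
    hf hg ?_ (ae_of_all _ fun z => ?_))
  · exact ω.aestronglyMeasurable_comp₂ hf.1 hg.1
  · rw [← NNReal.coe_le_coe]
    exact ω.le_opNorm₂ _ _

variable [CompleteSpace V] [MeasurableSpace V] [BorelSpace V] [SecondCountableTopology V]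

theorem lintegral_differenceQuotient_sq_le {F : ℂ → V} (hF : Differentiable ℝ F) {h : ℝ}
    (hh : h ≠ 0) (v : ℂ) :
    ∫⁻ z, ‖h⁻¹ • (F (z + h * v) - F z)‖ₑ ^ 2 ≤ ∫⁻ z, ‖fderiv ℝ F z v‖ₑ ^ 2 := by
  have hm : Measurable fun z => fderiv ℝ F z v := measurable_fderiv_apply_const ℝ F v
  have key : ∀ z, ‖h⁻¹ • (F (z + h * v) - F z)‖ₑ ^ 2 ≤
      ∫⁻ t in Set.Ioc (0 : ℝ) 1, ‖fderiv ℝ F (z + t * h * v) v‖ₑ ^ 2 := by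
    intro z
    have hd : ∀ t ∈ Set.Icc (0 : ℝ) 1, HasDerivAt (fun t : ℝ => h⁻¹ • F (z + t * h * v))
        (fderiv ℝ F (z + t * h * v) v) t := by
      intro t _
      have h1 : HasDerivAt (fun t : ℝ => z + t * h * v) (h * v) t := by
        simpa [mul_assoc] using ((Complex.ofRealCLM.hasDerivAt (x := t)).mul_const (h * v : ℂ)).const_add z
      have h2 := ((hF _).hasFDerivAt.comp_hasDerivAt t h1).const_smul h⁻¹
      have h3 : h⁻¹ • fderiv ℝ F (z + t * h * v) (h * v) = fderiv ℝ F (z + t * h * v) v := by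
        rw [← map_smul]; congr 1
        rw [Complex.real_smul, Complex.ofReal_inv, inv_mul_cancel_left₀ (by exact_mod_cast hh)]
      rw [h3] at h2
      exact h2
    have := enorm_sub_sq_le_lintegral_deriv zero_le_one hd
      (hm.comp (by fun_prop)).aestronglyMeasurable
    simpa [smul_sub] using this
  calc ∫⁻ z, ‖h⁻¹ • (F (z + h * v) - F z)‖ₑ ^ 2
      ≤ ∫⁻ z, ∫⁻ t in Set.Ioc (0 : ℝ) 1, ‖fderiv ℝ F (z + t * h * v) v‖ₑ ^ 2 := lintegral_mono key
    _ = ∫⁻ t in Set.Ioc (0 : ℝ) 1, ∫⁻ z, ‖fderiv ℝ F (z + t * h * v) v‖ₑ ^ 2 := by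
      refine lintegral_lintegral_swap (Measurable.aemeasurable ?_)
      refine (hm.comp ?_).enorm.pow_const 2
      fun_prop
    _ = ∫⁻ t in Set.Ioc (0 : ℝ) 1, ∫⁻ z, ‖fderiv ℝ F z v‖ₑ ^ 2 := by
      refine lintegral_congr fun t => ?_
      exact lintegral_add_right_eq_self (fun z => ‖fderiv ℝ F z v‖ₑ ^ 2) _
    _ = _ := by simp

/-- A weak form of Stokes' theorem for the pullback of a constant two-form. -/
theorem integral_form_fderiv_nonpos {F : ℂ → V} (hF : Differentiable ℝ F)
    (hc : HasCompactSupport F) (hx : MemLp (fun z => fderiv ℝ F z 1) 2)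
    (hy : MemLp (fun z => fderiv ℝ F z Complex.I) 2)
    (ω : V →L[ℝ] V →L[ℝ] ℝ) (hω : ∀ a b, ω a b = -ω b a) :
    ∫ z, ω (fderiv ℝ F z 1) (fderiv ℝ F z Complex.I) ≤ 0 := by
  have hFc : Continuous F := hF.continuous
  obtain ⟨C, hC⟩ := hc.exists_bound_of_continuous hFc
  have hF2 : MemLp F 2 := hFc.memLp_of_hasCompactSupport hc
  have hFt : ∀ c : ℂ, MemLp (fun z => F (z + c)) 2 := fun c =>
    hF2.comp_measurePreserving (measurePreserving_add_right volume c)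
  have hxt : ∀ c : ℂ, MemLp (fun z => fderiv ℝ F (z + c) 1) 2 := fun c =>
    hx.comp_measurePreserving (measurePreserving_add_right volume c)
  have hInt : ∀ {f g : ℂ → V}, MemLp f 2 → MemLp g 2 → Integrable fun z => ω (f z) (g z) :=
    fun hf hg => integrable_bilin_of_memLp_two ω hf hg
  have hsymm : ∀ c : ℂ, ∫ z, ω (fderiv ℝ F z 1) (F (z + c)) =
      ∫ z, ω (fderiv ℝ F z 1) (F (z - c)) := by
    intro c
    have h1 := integral_bilinear_hasLineDerivAt_right_eq_neg_left_of_integrable (μ := volume)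
      (B := ω) (v := (1 : ℂ)) (f := F) (f' := fun z => fderiv ℝ F z 1)
      (g := fun z => F (z + c)) (g' := fun z => fderiv ℝ F (z + c) 1)
      (hInt hx (hFt c)) (hInt hF2 (hxt c)) (hInt hF2 (hFt c))
      (fun z _ => (hF z).hasFDerivAt.hasLineDerivAt 1)
      (fun z _ => by
        have := (hF (z + c)).hasFDerivAt.comp z ((hasFDerivAt_id z).add_const c)
        simpa [Function.comp_def] using this.hasLineDerivAt 1)
    have h2 := integral_add_right_eq_self (μ := volume)
      (fun z => ω (F (z - c)) (fderiv ℝ F z 1)) c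
    simp only [add_sub_cancel_right] at h2
    rw [h2] at h1
    rw [← neg_eq_iff_eq_neg.2 h1, ← integral_neg]
    exact integral_congr_ae (ae_of_all _ fun z => by simp only; rw [hω, neg_neg])
  set D : ℝ → ℂ → V := fun h z => h⁻¹ • (F (z + h * Complex.I) - F z) with hD
  have hD2 : ∀ h, MemLp (D h) 2 := fun h => ((hFt _).sub hF2).const_smul _
  have hDY : ∀ h : ℝ, h ≠ 0 →
      ∫ z, ‖D h z‖ ^ 2 ≤ ∫ z, ‖fderiv ℝ F z Complex.I‖ ^ 2 := by
    intro h hh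
    have e : ∀ f : ℂ → V, MemLp f 2 → ENNReal.ofReal (∫ z, ‖f z‖ ^ 2) = ∫⁻ z, ‖f z‖ₑ ^ 2 := by
      intro f hf
      rw [ofReal_integral_eq_lintegral_ofReal ((memLp_two_iff_integrable_sq_norm hf.1).1 hf)
        (ae_of_all _ fun z => by positivity)]
      exact lintegral_congr fun z => by rw [ENNReal.ofReal_pow (norm_nonneg _), ofReal_norm]
    rw [← ENNReal.ofReal_le_ofReal_iff (integral_nonneg fun z => by positivity), e _ (hD2 h),
      e _ hy]
    exact lintegral_differenceQuotient_sq_le hF hh Complex.I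
  have hDlim : ∀ z, Filter.Tendsto (fun h : ℝ => D h z) (nhdsWithin 0 {0}ᶜ)
      (nhds (fderiv ℝ F z Complex.I)) := by
    intro z
    have := ((hF z).hasFDerivAt.hasLineDerivAt Complex.I).tendsto_slope_zero
    simpa [hD] using this
  have hseq : Filter.Tendsto (fun k : ℕ => 1 / ((k : ℝ) + 1)) Filter.atTop
      (nhdsWithin 0 {0}ᶜ) :=
    tendsto_nhdsWithin_iff.2 ⟨tendsto_one_div_add_atTop_nhds_zero_nat,
      Filter.Eventually.of_forall fun k => by
        simp only [Set.mem_compl_iff, Set.mem_singleton_iff]; positivity⟩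
  have hseq' : Filter.Tendsto (fun k : ℕ => -(1 / ((k : ℝ) + 1))) Filter.atTop
      (nhdsWithin 0 {0}ᶜ) :=
    tendsto_nhdsWithin_iff.2 ⟨by
      simpa only [neg_zero] using (tendsto_one_div_add_atTop_nhds_zero_nat (𝕜 := ℝ)).neg,
      Filter.Eventually.of_forall fun k => by
        simp only [Set.mem_compl_iff, Set.mem_singleton_iff, neg_eq_zero]; positivity⟩
  set a : ℝ → ℂ → ℝ := fun h z => ‖ω‖ * (2 * ‖fderiv ℝ F z 1‖ ^ 2 + (‖D h z‖ ^ 2 + ‖D (-h) z‖ ^ 2))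
    + (ω (fderiv ℝ F z 1) (D h z) + ω (fderiv ℝ F z 1) (D (-h) z)) with ha
  set l : ℂ → ℝ := fun z => ‖ω‖ * (2 * ‖fderiv ℝ F z 1‖ ^ 2 + (‖fderiv ℝ F z Complex.I‖ ^ 2 +
    ‖fderiv ℝ F z Complex.I‖ ^ 2)) + (ω (fderiv ℝ F z 1) (fderiv ℝ F z Complex.I) +
    ω (fderiv ℝ F z 1) (fderiv ℝ F z Complex.I)) with hl
  have hnn : ∀ x y y' : V, 0 ≤ ‖ω‖ * (2 * ‖x‖ ^ 2 + (‖y‖ ^ 2 + ‖y'‖ ^ 2)) + (ω x y + ω x y') := by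
    intro x y y'
    have h1 := neg_le_of_abs_le (ω.le_opNorm₂ x y)
    have h2 := neg_le_of_abs_le (ω.le_opNorm₂ x y')
    nlinarith [mul_nonneg (norm_nonneg ω) (sq_nonneg (‖x‖ - ‖y‖)),
      mul_nonneg (norm_nonneg ω) (sq_nonneg (‖x‖ - ‖y'‖)),
      mul_nonneg (norm_nonneg ω) (sq_nonneg ‖x‖), mul_nonneg (norm_nonneg ω) (sq_nonneg ‖y‖),
      mul_nonneg (norm_nonneg ω) (sq_nonneg ‖y'‖)]
  have hsq : ∀ {f : ℂ → V}, MemLp f 2 → Integrable fun z => ‖f z‖ ^ 2 := fun hf =>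
    (memLp_two_iff_integrable_sq_norm hf.1).1 hf
  have hai : ∀ h, Integrable (a h) := fun h =>
    ((((hsq hx).const_mul 2).add ((hsq (hD2 h)).add (hsq (hD2 (-h))))).const_mul _).add
      ((hInt hx (hD2 h)).add (hInt hx (hD2 (-h))))
  have hli : Integrable l :=
    ((((hsq hx).const_mul 2).add ((hsq hy).add (hsq hy))).const_mul _).add
      ((hInt hx hy).add (hInt hx hy))
  have hform : ∀ {f g : ℂ → V}, MemLp f 2 → MemLp g 2 →
      ∫ z, (‖ω‖ * (2 * ‖fderiv ℝ F z 1‖ ^ 2 + (‖f z‖ ^ 2 + ‖g z‖ ^ 2)) +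
        (ω (fderiv ℝ F z 1) (f z) + ω (fderiv ℝ F z 1) (g z))) =
      ‖ω‖ * (2 * ∫ z, ‖fderiv ℝ F z 1‖ ^ 2) + ‖ω‖ * ((∫ z, ‖f z‖ ^ 2) + ∫ z, ‖g z‖ ^ 2) +
        ((∫ z, ω (fderiv ℝ F z 1) (f z)) + ∫ z, ω (fderiv ℝ F z 1) (g z)) := by
    intro f g hf hg
    have e1 := integral_add ((((hsq hx).const_mul 2).add ((hsq hf).add (hsq hg))).const_mul ‖ω‖)
      ((hInt hx hf).add (hInt hx hg))
    have e2 := integral_add ((hsq hx).const_mul 2) ((hsq hf).add (hsq hg))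
    have e3 := integral_add (hsq hf) (hsq hg)
    have e4 := integral_add (hInt hx hf) (hInt hx hg)
    simp only [Pi.add_apply] at e1 e2 e3 e4
    rw [e1, integral_const_mul, e2, e3, e4, integral_const_mul, mul_add]
  have hzero : ∀ h, (∫ z, ω (fderiv ℝ F z 1) (D h z)) + ∫ z, ω (fderiv ℝ F z 1) (D (-h) z) = 0 := by
    intro h
    have e : ∀ h, ∫ z, ω (fderiv ℝ F z 1) (D h z) = h⁻¹ *
        ((∫ z, ω (fderiv ℝ F z 1) (F (z + h * Complex.I))) - ∫ z, ω (fderiv ℝ F z 1) (F z)) := by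
      intro h
      rw [← integral_sub (hInt hx (hFt _)) (hInt hx hF2), ← integral_const_mul]
      simp [hD]
    rw [e, e, hsymm (h * Complex.I)]
    simp only [Complex.ofReal_neg, neg_mul, ← sub_eq_add_neg, inv_neg]
    ring
  have hfatou : ∫⁻ z, ENNReal.ofReal (l z) ≤
      ENNReal.ofReal (‖ω‖ * (2 * ∫ z, ‖fderiv ℝ F z 1‖ ^ 2) +
        ‖ω‖ * (2 * ∫ z, ‖fderiv ℝ F z Complex.I‖ ^ 2)) := by
    have hptw : ∀ z, Filter.Tendsto (fun k : ℕ => ENNReal.ofReal (a (1 / ((k : ℝ) + 1)) z))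
        Filter.atTop (nhds (ENNReal.ofReal (l z))) := by
      intro z
      have h1 := (hDlim z).comp hseq
      have h2 := (hDlim z).comp hseq'
      refine (ENNReal.continuous_ofReal.tendsto _).comp ?_
      exact (((h1.norm.pow 2).add (h2.norm.pow 2)).const_add _ |>.const_mul _).add
        ((((ω (fderiv ℝ F z 1)).continuous.tendsto _).comp h1).add
          (((ω (fderiv ℝ F z 1)).continuous.tendsto _).comp h2))
    calc ∫⁻ z, ENNReal.ofReal (l z)
        = ∫⁻ z, Filter.liminf (fun k : ℕ => ENNReal.ofReal (a (1 / ((k : ℝ) + 1)) z))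
            Filter.atTop := lintegral_congr fun z => (hptw z).liminf_eq.symm
      _ ≤ Filter.liminf (fun k : ℕ => ∫⁻ z, ENNReal.ofReal (a (1 / ((k : ℝ) + 1)) z))
            Filter.atTop := by
          refine lintegral_liminf_le' fun k => ?_
          exact (hai _).1.aemeasurable.ennreal_ofReal
      _ ≤ _ := by
          refine Filter.liminf_le_of_le (by isBoundedDefault) fun b hb => ?_
          obtain ⟨k, hk⟩ := hb.exists
          refine hk.trans ?_
          rw [← ofReal_integral_eq_lintegral_ofReal (hai _) (ae_of_all _ fun z => hnn _ _ _)]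
          refine ENNReal.ofReal_le_ofReal ?_
          have hk0 : 1 / ((k : ℝ) + 1) ≠ 0 := by positivity
          rw [hform (hD2 _) (hD2 _), hzero, add_zero, two_mul (∫ z, ‖fderiv ℝ F z Complex.I‖ ^ 2)]
          exact add_le_add_right (mul_le_mul_of_nonneg_left
            (add_le_add (hDY _ hk0) (hDY _ (neg_ne_zero.2 hk0))) (norm_nonneg ω)) _
  rw [← ofReal_integral_eq_lintegral_ofReal hli (ae_of_all _ fun z => hnn _ _ _),
    ENNReal.ofReal_le_ofReal_iff (by positivity), hform hy hy] at hfatou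
  linarith

end Stokes

section Slicing

variable {V : Type*} [NormedAddCommGroup V] [NormedSpace ℝ V]

theorem clm_apply_eq_re_smul_add_im_smul (L : ℂ →L[ℝ] V) (ζ : ℂ) :
    L ζ = ζ.re • L 1 + ζ.im • L Complex.I := by
  rw [← map_smul, ← map_smul, ← map_add]
  congr 1
  apply Complex.ext <;> simp

variable [CompleteSpace V] [MeasurableSpace V] [BorelSpace V] [SecondCountableTopology V]

theorem setLIntegral_reProdIm {s t : Set ℝ} (hs : MeasurableSet s) (ht : MeasurableSet t)
    {f : ℂ → ENNReal} (hf : Measurable f) :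
    ∫⁻ z in s ×ℂ t, f z = ∫⁻ y in t, ∫⁻ x in s, f (x + y * Complex.I) := by
  have hm := Complex.volume_preserving_equiv_real_prod.symm Complex.measurableEquivRealProd
  have hst : MeasurableSet (s ×ℂ t) :=
    (Complex.measurable_re hs).inter (Complex.measurable_im ht)
  rw [← hm.setLIntegral_comp_preimage hst hf]
  have hpre : Complex.measurableEquivRealProd.symm ⁻¹' (s ×ℂ t) = s ×ˢ t := by
    ext p
    simp [Complex.mem_reProdIm, Complex.measurableEquivRealProd]
  rw [hpre, Measure.volume_eq_prod, ← Measure.prod_restrict, lintegral_prod_symm']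
  · refine lintegral_congr fun y => lintegral_congr fun x => ?_
    congr 1
    apply Complex.ext <;> simp [Complex.measurableEquivRealProd]
  · exact hf.comp Complex.measurableEquivRealProd.symm.measurable

/-- Near a point of nonzero derivative, the energy of `u` over a small square is at least
comparable to the square of the diameter of the image. -/
theorem exists_square_le_lintegral {u : ℂ → V} {Ω : Set ℂ} (hΩ : IsOpen Ω)
    (hu : ∀ z ∈ Ω, DifferentiableAt ℝ u z) {z₁ : ℂ} (hz₁ : z₁ ∈ Ω) {N : ℝ} (hN : 1 ≤ N)
    (hI : ‖fderiv ℝ u z₁ Complex.I‖ ≤ N * ‖fderiv ℝ u z₁ 1‖) (h1 : fderiv ℝ u z₁ 1 ≠ 0)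
    {κ : ℝ} (hκ : 0 < κ) :
    ∃ ρ, 0 < ρ ∧ ρ < κ ∧ ∃ Q ⊆ Ω, MeasurableSet Q ∧
      (∀ z ∈ Q, ‖u z - u z₁‖ ≤ 4 * N * ρ * ‖fderiv ℝ u z₁ 1‖) ∧
      ENNReal.ofReal (ρ ^ 2 * ‖fderiv ℝ u z₁ 1‖ ^ 2) ≤ ∫⁻ z in Q, ‖fderiv ℝ u z 1‖ₑ ^ 2 := by
  set L := fderiv ℝ u z₁ with hL
  have hpos : 0 < ‖L 1‖ := norm_pos_iff.2 h1
  have hlo := (hu z₁ hz₁).hasFDerivAt.isLittleO.def (c := ‖L 1‖ / 4) (by positivity)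
  obtain ⟨r, hr, hball⟩ := Metric.eventually_nhds_iff.1 (hlo.and (hΩ.mem_nhds hz₁))
  obtain ⟨ρ, hρ, hρκ⟩ := exists_between (lt_min hκ (half_pos hr))
  obtain ⟨hρ1, hρ2⟩ := lt_min_iff.1 hρκ
  have hdist : ∀ z : ℂ, |z.re - z₁.re| ≤ ρ → |z.im - z₁.im| ≤ ρ → ‖z - z₁‖ ≤ 2 * ρ := by
    intro z h1 h2
    have := Complex.norm_le_abs_re_add_abs_im (z - z₁)
    simp only [Complex.sub_re, Complex.sub_im] at this
    linarith
  have hmem : ∀ z : ℂ, |z.re - z₁.re| ≤ ρ → |z.im - z₁.im| ≤ ρ →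
      ‖u z - u z₁ - L (z - z₁)‖ ≤ ‖L 1‖ / 2 * ρ ∧ z ∈ Ω := by
    intro z h1 h2
    have h3 := hdist z h1 h2
    obtain ⟨h4, h5⟩ := hball (show dist z z₁ < r by rw [dist_eq_norm]; linarith)
    refine ⟨h4.trans ?_, h5⟩
    nlinarith
  refine ⟨ρ, hρ, hρ1, Set.Ioc (z₁.re - ρ) (z₁.re + ρ) ×ℂ Set.Ioc (z₁.im - ρ) (z₁.im + ρ),
    ?_, ?_, ?_, ?_⟩
  · rintro z ⟨⟨ha, hb⟩, ⟨hc, hd⟩⟩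
    exact (hmem z (abs_le.2 ⟨by linarith, by linarith⟩) (abs_le.2 ⟨by linarith, by linarith⟩)).2
  · exact (Complex.measurable_re measurableSet_Ioc).inter (Complex.measurable_im measurableSet_Ioc)
  · rintro z ⟨⟨ha, hb⟩, ⟨hc, hd⟩⟩
    have hre : |z.re - z₁.re| ≤ ρ := abs_le.2 ⟨by linarith, by linarith⟩
    have him : |z.im - z₁.im| ≤ ρ := abs_le.2 ⟨by linarith, by linarith⟩
    have h3 := (hmem z hre him).1
    have h4 : ‖L (z - z₁)‖ ≤ 2 * N * ρ * ‖L 1‖ := by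
      rw [clm_apply_eq_re_smul_add_im_smul L]
      refine (norm_add_le _ _).trans ?_
      rw [norm_smul, norm_smul, Complex.sub_re, Complex.sub_im, Real.norm_eq_abs, Real.norm_eq_abs]
      have e1 : |z.re - z₁.re| * ‖L 1‖ ≤ ρ * (N * ‖L 1‖) :=
        mul_le_mul hre (by nlinarith) hpos.le hρ.le
      have e2 : |z.im - z₁.im| * ‖L Complex.I‖ ≤ ρ * (N * ‖L 1‖) :=
        mul_le_mul him hI (norm_nonneg _) hρ.le
      linarith
    have h5 : ‖u z - u z₁‖ ≤ ‖u z - u z₁ - L (z - z₁)‖ + ‖L (z - z₁)‖ := by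
      simpa using norm_add_le (u z - u z₁ - L (z - z₁)) (L (z - z₁))
    nlinarith [mul_pos hρ hpos]
  · have hm : Measurable fun z => ‖fderiv ℝ u z 1‖ₑ ^ 2 :=
      (measurable_fderiv_apply_const ℝ u 1).enorm.pow_const 2
    rw [setLIntegral_reProdIm measurableSet_Ioc measurableSet_Ioc hm]
    have hslice : ∀ y ∈ Set.Ioc (z₁.im - ρ) (z₁.im + ρ),
        ENNReal.ofReal (ρ * ‖L 1‖ ^ 2 / 2) ≤
          ∫⁻ x in Set.Ioc (z₁.re - ρ) (z₁.re + ρ), ‖fderiv ℝ u (x + y * Complex.I) 1‖ₑ ^ 2 := by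
      intro y hy
      have him : |y - z₁.im| ≤ ρ := abs_le.2 ⟨by linarith [hy.1], by linarith [hy.2]⟩
      have hd : ∀ x ∈ Set.Icc (z₁.re - ρ) (z₁.re + ρ),
          HasDerivAt (fun x : ℝ => u (x + y * Complex.I)) (fderiv ℝ u (x + y * Complex.I) 1) x := by
        intro x hx
        have h2 : HasDerivAt (fun x : ℝ => (x : ℂ) + y * Complex.I) 1 x :=
          (Complex.ofRealCLM.hasDerivAt (x := x)).add_const _
        exact (hu _ (hmem _ (by simpa using abs_le.2 ⟨by linarith [hx.1], by linarith [hx.2]⟩)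
          (by simpa using him)).2).hasFDerivAt.comp_hasDerivAt x h2
      have h6 := enorm_sub_sq_le_lintegral_deriv (by linarith) hd
        ((measurable_fderiv_apply_const ℝ u 1).comp (g := fun z => fderiv ℝ u z 1)
          (by fun_prop : Measurable fun x : ℝ => (x + y * Complex.I : ℂ))).aestronglyMeasurable
      have ea := (hmem ((z₁.re + ρ : ℝ) + y * Complex.I)
        (by simp [abs_of_pos hρ]) (by simpa using him)).1
      have eb := (hmem ((z₁.re - ρ : ℝ) + y * Complex.I)
        (by simp [abs_of_pos hρ]) (by simpa using him)).1
      have hdiff : ρ * ‖L 1‖ ≤ ‖u ((z₁.re + ρ : ℝ) + y * Complex.I) -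
          u ((z₁.re - ρ : ℝ) + y * Complex.I)‖ := by
        set p : ℂ := (z₁.re + ρ : ℝ) + y * Complex.I with hp
        set q : ℂ := (z₁.re - ρ : ℝ) + y * Complex.I with hq
        have hpq : L (p - z₁) - L (q - z₁) = (2 * ρ) • L 1 := by
          rw [← map_sub, ← map_smul]
          congr 1
          apply Complex.ext <;> simp [hp, hq]
          ring
        have hn : 2 * ρ * ‖L 1‖ = ‖L (p - z₁) - L (q - z₁)‖ := by
          rw [hpq, norm_smul, Real.norm_of_nonneg (by positivity)]
        have : L (p - z₁) - L (q - z₁) = (u p - u q) - (u p - u z₁ - L (p - z₁)) +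
          (u q - u z₁ - L (q - z₁)) := by abel
        rw [this] at hn
        have t1 := norm_add_le ((u p - u q) - (u p - u z₁ - L (p - z₁))) (u q - u z₁ - L (q - z₁))
        have t2 := norm_sub_le (u p - u q) (u p - u z₁ - L (p - z₁))
        linarith
      have h7 : ENNReal.ofReal (ρ ^ 2 * ‖L 1‖ ^ 2) ≤ ‖u ((z₁.re + ρ : ℝ) + y * Complex.I) -
          u ((z₁.re - ρ : ℝ) + y * Complex.I)‖ₑ ^ 2 := by
        rw [← ofReal_norm, ← ENNReal.ofReal_pow (norm_nonneg _), ← mul_pow]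
        exact ENNReal.ofReal_le_ofReal (pow_le_pow_left₀ (by positivity) hdiff 2)
      have h8 := h7.trans h6
      have e3 : z₁.re + ρ - (z₁.re - ρ) = 2 * ρ := by ring
      rw [e3, mul_comm (ENNReal.ofReal _), ← ENNReal.div_le_iff (by simpa using hρ) ENNReal.ofReal_ne_top,
        ← ENNReal.ofReal_div_of_pos (by positivity)] at h8
      convert h8 using 2
      field_simp
    calc ENNReal.ofReal (ρ ^ 2 * ‖L 1‖ ^ 2)
        = ∫⁻ _ in Set.Ioc (z₁.im - ρ) (z₁.im + ρ), ENNReal.ofReal (ρ * ‖L 1‖ ^ 2 / 2) := by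
          rw [setLIntegral_const, Real.volume_Ioc, ← ENNReal.ofReal_mul (by positivity)]
          congr 1; ring
      _ ≤ _ := setLIntegral_mono' measurableSet_Ioc hslice

/-- The Courant–Lebesgue lemma: a map of finite energy on a punctured disk has small oscillation
on some arbitrarily small circles. -/
theorem exists_circle_oscillation_le {u : ℂ → V}
    (hu : ∀ z ∈ Metric.ball (0 : ℂ) 1 \ {0}, DifferentiableAt ℝ u z)
    (hE : ∫⁻ z in Metric.ball (0 : ℂ) 1 \ {0}, ‖fderiv ℝ u z‖ₑ ^ 2 ≠ ⊤)
    {ε ρ : ℝ} (hε : 0 < ε) (hρ : 0 < ρ) (hρ1 : ρ ≤ 1) :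
    ∃ r ∈ Set.Ioo 0 ρ, ∀ z w : ℂ, ‖z‖ = r → ‖w‖ = r → ‖u z - u w‖ ≤ ε := by
  by_contra! hcon
  apply hE
  have hm : Measurable fun z => ‖fderiv ℝ u z‖ₑ ^ 2 := (measurable_fderiv ℝ u).enorm.pow_const 2
  have hset : MeasurableSet (Metric.ball (0 : ℂ) 1 \ {0}) :=
    measurableSet_ball.diff (measurableSet_singleton 0)
  have hcirc : ∀ r ∈ Set.Ioo 0 ρ, ENNReal.ofReal (ε ^ 2 / (2 * Real.pi) * r⁻¹) ≤
      ∫⁻ t in Set.Ioo (-Real.pi) Real.pi, ENNReal.ofReal r *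
        ‖fderiv ℝ u (r * (Real.cos t + Real.sin t * Complex.I))‖ₑ ^ 2 := by
    intro r hr
    have hr0 := hr.1
    have hmc : Measurable fun t : ℝ =>
        ‖fderiv ℝ u (r * (Real.cos t + Real.sin t * Complex.I))‖ₑ ^ 2 := hm.comp (by fun_prop)
    rw [restrict_Ioo_eq_restrict_Ioc, lintegral_const_mul _ hmc]
    set S := ∫⁻ t in Set.Ioc (-Real.pi) Real.pi,
        ‖fderiv ℝ u (r * (Real.cos t + Real.sin t * Complex.I))‖ₑ ^ 2 with hS
    obtain ⟨z, w, hz, hw, hzw⟩ := hcon r hr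
    have key : ∀ z w : ℂ, ‖z‖ = r → ‖w‖ = r → z.arg ≤ w.arg →
        ‖u w - u z‖ₑ ^ 2 ≤ ENNReal.ofReal (2 * Real.pi * r ^ 2) * S := by
      intro z w hz hw hle
      have hcis : ∀ z : ℂ, ‖z‖ = r →
          z = r * (Real.cos z.arg + Real.sin z.arg * Complex.I) := by
        intro z hz
        rw [← hz]
        push_cast
        exact (Complex.norm_mul_cos_add_sin_mul_I z).symm
      have hd : ∀ t ∈ Set.Icc z.arg w.arg,
          HasDerivAt (fun t : ℝ => u (r * (Real.cos t + Real.sin t * Complex.I)))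
          (fderiv ℝ u (r * (Real.cos t + Real.sin t * Complex.I))
            (r * (-Real.sin t + Real.cos t * Complex.I))) t := by
        intro t _
        have h2 : HasDerivAt (fun t : ℝ => (r * (Real.cos t + Real.sin t * Complex.I) : ℂ))
            (r * (-Real.sin t + Real.cos t * Complex.I)) t := by
          have h3 := (Real.hasDerivAt_cos t).ofReal_comp
          have h4 := (Real.hasDerivAt_sin t).ofReal_comp
          simpa using (h3.add (h4.mul_const Complex.I)).const_mul (r : ℂ)
        refine (hu _ ?_).hasFDerivAt.comp_hasDerivAt t h2
        have hn : ‖(r * (Real.cos t + Real.sin t * Complex.I) : ℂ)‖ = r := by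
          rw [norm_mul, Complex.ofReal_cos, Complex.ofReal_sin,
            Complex.norm_cos_add_sin_mul_I, Complex.norm_real,
            Real.norm_of_nonneg hr0.le, mul_one]
        refine ⟨by rw [mem_ball_zero_iff, hn]; linarith [hr.2], fun h => ?_⟩
        rw [Set.mem_singleton_iff.1 h, norm_zero] at hn
        linarith
      have h5 := enorm_sub_sq_le_lintegral_deriv hle hd (by
        have hm1 : ∀ v : ℂ, Measurable fun t : ℝ =>
            fderiv ℝ u (r * (Real.cos t + Real.sin t * Complex.I)) v := fun v =>
          (measurable_fderiv_apply_const ℝ u v).comp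
            (by fun_prop : Measurable fun t : ℝ =>
              (r * (Real.cos t + Real.sin t * Complex.I) : ℂ))
        refine Measurable.aestronglyMeasurable ?_
        simp only [fun t : ℝ => clm_apply_eq_re_smul_add_im_smul
          (fderiv ℝ u (r * (Real.cos t + Real.sin t * Complex.I)))
          (r * (-Real.sin t + Real.cos t * Complex.I))]
        exact ((Complex.measurable_re.comp (by fun_prop)).smul (hm1 1)).add
          ((Complex.measurable_im.comp (by fun_prop)).smul (hm1 Complex.I)))
      simp only [← hcis z hz, ← hcis w hw] at h5
      refine h5.trans ?_
      have h6 : ENNReal.ofReal (2 * Real.pi * r ^ 2) * S =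
          ENNReal.ofReal (2 * Real.pi) * (ENNReal.ofReal (r ^ 2) * S) := by
        rw [ENNReal.ofReal_mul (by positivity), mul_assoc]
      rw [h6, hS, ← lintegral_const_mul _ hmc]
      refine mul_le_mul' (ENNReal.ofReal_le_ofReal (by
        linarith [Complex.neg_pi_lt_arg z, Complex.arg_le_pi w])) ?_
      refine (lintegral_mono_set (Set.Ioc_subset_Ioc (Complex.neg_pi_lt_arg z).le
        (Complex.arg_le_pi w))).trans (lintegral_mono fun t => ?_)
      simp only
      have h7 : ‖(r * (-Real.sin t + Real.cos t * Complex.I) : ℂ)‖ₑ = ENNReal.ofReal r := by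
        rw [← ofReal_norm]
        congr 1
        have : (r * (-Real.sin t + Real.cos t * Complex.I) : ℂ) =
            r * ((Real.cos t + Real.sin t * Complex.I) * Complex.I) := by
          linear_combination (-r * Real.sin t : ℂ) * Complex.I_sq
        rw [this, norm_mul, norm_mul, Complex.ofReal_cos, Complex.ofReal_sin,
          Complex.norm_cos_add_sin_mul_I, Complex.norm_real, Complex.norm_I,
          Real.norm_of_nonneg hr0.le, mul_one, mul_one]
      rw [ENNReal.ofReal_pow hr0.le, ← h7, ← mul_pow, mul_comm ‖_‖ₑ]
      exact pow_le_pow_left' (ContinuousLinearMap.le_opENorm _ _) 2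
    have hzw2 : ENNReal.ofReal (ε ^ 2) ≤ ENNReal.ofReal (2 * Real.pi * r ^ 2) * S := by
      have h8 : ENNReal.ofReal (ε ^ 2) ≤ ‖u z - u w‖ₑ ^ 2 := by
        rw [← ofReal_norm, ← ENNReal.ofReal_pow (norm_nonneg _)]
        exact ENNReal.ofReal_le_ofReal (pow_le_pow_left₀ hε.le hzw.le 2)
      rcases le_total z.arg w.arg with h | h
      · refine h8.trans ?_
        rw [← enorm_neg, neg_sub]
        exact key z w hz hw h
      · exact h8.trans (key w z hw hz h)
    have h9 := mul_le_mul_right hzw2 (ENNReal.ofReal (1 / (2 * Real.pi * r)))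
    rw [← mul_assoc, ← ENNReal.ofReal_mul (by positivity), ← ENNReal.ofReal_mul (by positivity)] at h9
    convert h9 using 2
    · field_simp
    · congr 1; field_simp
  have hlog : ∫⁻ r in Set.Ioo 0 ρ, ENNReal.ofReal (ε ^ 2 / (2 * Real.pi) * r⁻¹) = ⊤ := by
    by_contra hne
    have hi : IntegrableOn (fun r : ℝ => ε ^ 2 / (2 * Real.pi) * r⁻¹) (Set.Ioo 0 ρ) := by
      refine (lintegral_ofReal_ne_top_iff_integrable (by fun_prop) ?_).1 hne
      filter_upwards [ae_restrict_mem measurableSet_Ioo] with r hr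
      have := hr.1
      simp only [Pi.zero_apply]; positivity
    have hi2 : IntegrableOn (fun r : ℝ => r ^ (-1 : ℝ)) (Set.Ioo 0 ρ) := by
      have := hi.const_mul (ε ^ 2 / (2 * Real.pi))⁻¹
      refine this.congr (ae_of_all _ fun r => ?_)
      simp only [Real.rpow_neg_one]
      field_simp
    exact lt_irrefl _ ((intervalIntegral.integrableOn_Ioo_rpow_iff hρ).1 hi2)
  rw [← top_le_iff, ← hlog]
  rw [← lintegral_indicator hset, ← Complex.lintegral_comp_polarCoord_symm]
  have htarget : polarCoord.target = Set.Ioi (0 : ℝ) ×ˢ Set.Ioo (-Real.pi) Real.pi := rfl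
  have hmeas : Measurable fun p : ℝ × ℝ => ENNReal.ofReal p.1 • (Metric.ball (0 : ℂ) 1 \ {0}).indicator
      (fun z => ‖fderiv ℝ u z‖ₑ ^ 2) (Complex.polarCoord.symm p) := by
    simp only [Complex.polarCoord_symm_apply]
    exact (by fun_prop : Measurable fun p : ℝ × ℝ => ENNReal.ofReal p.1).smul
      ((hm.indicator hset).comp (by fun_prop : Measurable fun p : ℝ × ℝ =>
        (p.1 * (Real.cos p.2 + Real.sin p.2 * Complex.I) : ℂ)))
  rw [htarget, Measure.volume_eq_prod, ← Measure.prod_restrict, lintegral_prod _ hmeas.aemeasurable]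
  refine le_trans ?_ (lintegral_mono_set (Set.Ioo_subset_Ioi_self : Set.Ioo 0 ρ ⊆ Set.Ioi 0))
  refine setLIntegral_mono' measurableSet_Ioo fun r hr => (hcirc r hr).trans_eq ?_
  refine lintegral_congr fun t => ?_
  have hr0 := hr.1
  have hn : ‖(r * (Real.cos t + Real.sin t * Complex.I) : ℂ)‖ = r := by
    rw [norm_mul, Complex.ofReal_cos, Complex.ofReal_sin,
      Complex.norm_cos_add_sin_mul_I, Complex.norm_real,
      Real.norm_of_nonneg hr0.le, mul_one]
  rw [Complex.polarCoord_symm_apply, Set.indicator_of_mem, smul_eq_mul]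
  refine ⟨by rw [mem_ball_zero_iff, hn]; linarith [hr.2], fun h => ?_⟩
  rw [Set.mem_singleton_iff.1 h, norm_zero] at hn
  linarith

end Slicing

section HermitianForm

variable {V : Type*} [NormedAddCommGroup V] [NormedSpace ℝ V]

/-- The form `B` is a bounded symmetric form, invariant under the complex structure `J`, and
dominating the square of the norm. -/
structure IsHermitianForm (B : V →L[ℝ] V →L[ℝ] ℝ) (J : V →L[ℝ] V) (N Λ : ℝ) : Prop where
  symm : ∀ a b, B a b = B b a
  sq : ∀ a, J (J a) = -a
  invariant : ∀ a b, B (J a) (J b) = B a b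
  sq_norm_le : ∀ a, ‖a‖ ^ 2 ≤ B a a
  abs_apply_le : ∀ a b, |B a b| ≤ Λ * ‖a‖ * ‖b‖
  norm_le : ∀ a, ‖J a‖ ≤ N * ‖a‖
  one_le_N : 1 ≤ N
  one_le_Λ : 1 ≤ Λ

namespace IsHermitianForm

variable {B : V →L[ℝ] V →L[ℝ] ℝ} {J : V →L[ℝ] V} {N Λ : ℝ}

theorem nonneg (h : IsHermitianForm B J N Λ) (a : V) : 0 ≤ B a a :=
  (sq_nonneg _).trans (h.sq_norm_le a)

theorem apply_le (h : IsHermitianForm B J N Λ) (a : V) : B a a ≤ Λ * ‖a‖ ^ 2 := by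
  have := (le_abs_self _).trans (h.abs_apply_le a a)
  nlinarith

theorem left_eq_neg_right (h : IsHermitianForm B J N Λ) (a b : V) : B (J a) b = -B a (J b) := by
  rw [← h.invariant (J a) b, h.sq, map_neg, neg_apply]

theorem form_antisymm (h : IsHermitianForm B J N Λ) (a b : V) : B (J a) b = -B (J b) a := by
  rw [h.left_eq_neg_right a b, h.symm]

/-- The complex Cauchy–Schwarz inequality. -/
theorem sq_add_sq_le (h : IsHermitianForm B J N Λ) (w v : V) :
    B w v ^ 2 + B w (J v) ^ 2 ≤ B w w * B v v := by
  rcases eq_or_ne v 0 with rfl | hv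
  · simp
  have he : 0 < B v v := (by positivity : 0 < ‖v‖ ^ 2).trans_le (h.sq_norm_le v)
  have h0 : B v (J v) = 0 := by
    have := h.left_eq_neg_right v v
    rw [h.symm] at this
    linarith
  have h1 : B (J v) v = 0 := by rw [h.symm, h0]
  have hy := h.nonneg (B v v • w - B w v • v - B w (J v) • J v)
  simp only [map_sub, map_smul, sub_apply, smul_apply,
    smul_eq_mul, h.invariant, h0, h1, h.symm v w, h.symm (J v) w] at hy
  have : 0 ≤ B v v * (B w w * B v v - (B w v ^ 2 + B w (J v) ^ 2)) := by
    refine hy.trans_eq ?_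
    ring
  have := nonneg_of_mul_nonneg_right this he
  linarith

theorem le_form_apply (h : IsHermitianForm B J N Λ) {v v' : V} {θ : ℝ}
    (hθ : ‖v' - J v‖ ≤ θ * ‖v‖) :
    (1 - 2 * Λ ^ 2 * N * θ) * B v v ≤ B (J v) v' := by
  have h1 : B (J v) v' = B v v + B (J v) (v' - J v) := by
    rw [map_sub, h.invariant]; ring
  have hN := h.one_le_N
  have hΛ := h.one_le_Λ
  have h2 : |B (J v) (v' - J v)| ≤ Λ * (N * ‖v‖) * (θ * ‖v‖) :=
    (h.abs_apply_le _ _).trans (mul_le_mul (mul_le_mul_of_nonneg_left (h.norm_le v) (by linarith)) hθ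
      (norm_nonneg _) (by positivity))
  have h3 := (abs_le.1 h2).1
  rcases eq_or_ne v 0 with rfl | hv
  · simp at h3 ⊢
  have hv' := norm_pos_iff.2 hv
  have hθ0 : 0 ≤ θ := nonneg_of_mul_nonneg_left ((norm_nonneg _).trans hθ) hv'
  have h4 := h.sq_norm_le v
  have h5 : Λ * N * θ * ‖v‖ ^ 2 ≤ Λ * N * θ * B v v := by gcongr
  have h6 : Λ * N * θ * B v v ≤ (2 * Λ) * (Λ * N * θ * B v v) := by
    have := h.nonneg v
    exact le_mul_of_one_le_left (by positivity) (by linarith)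
  rw [h1]
  linarith

theorem mul_sub_mul_le (h : IsHermitianForm B J N Λ) {w v v' : V} {θ : ℝ}
    (hθ : ‖v' - J v‖ ≤ θ * ‖v‖) :
    B w v * B (J w) v' - B w v' * B (J w) v ≤
      (1 + 2 * Λ ^ 2 * N * θ) * (B w w * B v v) := by
  set d := v' - J v with hd
  have hv' : v' = J v + d := by rw [hd]; abel
  have hN := h.one_le_N
  have hΛ := h.one_le_Λ
  have hθ' : 0 ≤ θ * ‖v‖ := (norm_nonneg _).trans hθ
  have e1 : |B w v| ≤ Λ * ‖w‖ * ‖v‖ := h.abs_apply_le _ _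
  have e2 : |B (J w) d| ≤ Λ * (N * ‖w‖) * (θ * ‖v‖) :=
    (h.abs_apply_le _ _).trans (mul_le_mul (mul_le_mul_of_nonneg_left (h.norm_le w) (by linarith)) hθ
      (norm_nonneg _) (by positivity))
  have e3 : |B w d| ≤ Λ * ‖w‖ * (θ * ‖v‖) :=
    (h.abs_apply_le _ _).trans (mul_le_mul_of_nonneg_left hθ (by positivity))
  have e4 : |B (J w) v| ≤ Λ * (N * ‖w‖) * ‖v‖ :=
    (h.abs_apply_le _ _).trans (mul_le_mul_of_nonneg_right
      (mul_le_mul_of_nonneg_left (h.norm_le w) (by linarith)) (norm_nonneg _))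
  have f1 : B w v * B (J w) d ≤ (Λ * ‖w‖ * ‖v‖) * (Λ * (N * ‖w‖) * (θ * ‖v‖)) := by
    refine (le_abs_self _).trans ?_
    rw [abs_mul]
    exact mul_le_mul e1 e2 (abs_nonneg _) (by positivity)
  have f2 : -(B w d * B (J w) v) ≤ (Λ * ‖w‖ * (θ * ‖v‖)) * (Λ * (N * ‖w‖) * ‖v‖) := by
    refine (neg_le_abs _).trans ?_
    rw [abs_mul]
    exact mul_le_mul e3 e4 (abs_nonneg _) (by positivity)
  have f3 := h.sq_add_sq_le w v
  have f4 : B w v * B (J w) v' - B w v' * B (J w) v =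
      (B w v ^ 2 + B w (J v) ^ 2) + B w v * B (J w) d - B w d * B (J w) v := by
    rw [hv', map_add, map_add, h.invariant, h.left_eq_neg_right w v]; ring
  have f5 : Λ ^ 2 * N * (θ * ‖v‖ * ‖v‖) * ‖w‖ ^ 2 ≤ Λ ^ 2 * N * θ * (B w w * B v v) := by
    rcases eq_or_ne v 0 with rfl | hv
    · simp
    have hv' := norm_pos_iff.2 hv
    have hθ0 : 0 ≤ θ := nonneg_of_mul_nonneg_left hθ' hv'
    have : ‖w‖ ^ 2 * ‖v‖ ^ 2 ≤ B w w * B v v :=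
      mul_le_mul (h.sq_norm_le w) (h.sq_norm_le v) (by positivity) (h.nonneg w)
    calc _ = Λ ^ 2 * N * θ * (‖w‖ ^ 2 * ‖v‖ ^ 2) := by ring
      _ ≤ _ := by gcongr
  rw [f4]
  linarith

end IsHermitianForm

/-- Averaging a bounded inner product over a complex structure. -/
theorem exists_isHermitianForm {n : ℕ} {N : ℝ} (hN : 1 ≤ N) :
    ∃ Λ : ℝ, ∀ J : (Fin n → ℂ) →L[ℝ] (Fin n → ℂ), ‖J‖ ≤ N → (∀ a, J (J a) = -a) →
      ∃ B, IsHermitianForm B J N Λ := by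
  let b : (Fin n → ℂ) →L[ℝ] (Fin n → ℂ) →L[ℝ] ℝ :=
    ∑ i, (innerSL ℝ (E := ℂ)).bilinearComp (ContinuousLinearMap.proj i)
      (ContinuousLinearMap.proj i)
  have hb : ∀ x y, b x y = ∑ i, inner ℝ (x i) (y i) := by
    intro x y
    simp [b]
  have hb_symm : ∀ x y, b x y = b y x := fun x y => by
    simp only [hb]
    exact Finset.sum_congr rfl fun i _ => real_inner_comm _ _
  have hb0 : ∀ x, ‖x‖ ^ 2 ≤ b x x := by
    intro x
    have hnn : ∀ i, 0 ≤ inner ℝ (x i) (x i) := fun i => real_inner_self_nonneg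
    have h0 : 0 ≤ b x x := by rw [hb]; exact Finset.sum_nonneg fun i _ => hnn i
    rw [← Real.le_sqrt (norm_nonneg _) h0]
    refine (pi_norm_le_iff_of_nonneg (Real.sqrt_nonneg _)).2 fun i => Real.le_sqrt_of_sq_le ?_
    rw [hb, ← real_inner_self_eq_norm_sq]
    exact Finset.single_le_sum (f := fun i => inner ℝ (x i) (x i)) (fun i _ => hnn i)
      (Finset.mem_univ i)
  refine ⟨‖b‖ * (1 + N ^ 2) + 1, fun J hJ hsq => ⟨b + b.bilinearComp J J, ?_⟩⟩
  have hJa : ∀ a, ‖J a‖ ≤ N * ‖a‖ := fun a => J.le_of_opNorm_le hJ a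
  refine ⟨fun a c => ?_, hsq, fun a c => ?_, fun a => ?_, fun a c => ?_, hJa, hN, ?_⟩
  · simp [hb_symm a c, hb_symm (J a) (J c)]
  · simp [hsq, add_comm]
  · have h1 := hb0 a
    have h2 := (sq_nonneg _).trans (hb0 (J a))
    simp only [add_apply, ContinuousLinearMap.bilinearComp_apply]
    linarith
  · have h1 := b.le_opNorm₂ a c
    have h2 := b.le_opNorm₂ (J a) (J c)
    have h3 : ‖b‖ * ‖J a‖ * ‖J c‖ ≤ ‖b‖ * (N * ‖a‖) * (N * ‖c‖) := by
      gcongr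
      exacts [hJa a, hJa c]
    have h4 := norm_add_le (b a c) (b (J a) (J c))
    simp only [add_apply, ContinuousLinearMap.bilinearComp_apply,
      ← Real.norm_eq_abs]
    nlinarith [mul_nonneg (norm_nonneg a) (norm_nonneg c)]
  · have := mul_nonneg (norm_nonneg b) (by positivity : 0 ≤ 1 + N ^ 2)
    linarith

end HermitianForm

section Weight

theorem hasDerivAt_max_zero_sq (x : ℝ) :
    HasDerivAt (fun x : ℝ => max x 0 ^ 2) (2 * max x 0) x := by
  rcases lt_trichotomy x 0 with hx | rfl | hx
  · rw [max_eq_right hx.le, mul_zero]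
    refine (hasDerivAt_const x (0 : ℝ)).congr_of_eventuallyEq ?_
    filter_upwards [gt_mem_nhds hx] with y hy
    rw [max_eq_right hy.le]; norm_num
  · rw [max_self, mul_zero, hasDerivAt_iff_isLittleO_nhds_zero]
    simp only [zero_add, max_self, smul_zero, sub_zero]
    have h : (fun h : ℝ => max h 0 ^ 2 - 0 ^ 2) =O[nhds 0] fun h => h ^ 2 := by
      refine Asymptotics.IsBigO.of_bound 1 (Filter.Eventually.of_forall fun h => ?_)
      rw [one_mul, zero_pow two_ne_zero, sub_zero, norm_pow, norm_pow]
      refine pow_le_pow_left₀ (norm_nonneg _) ?_ 2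
      rw [Real.norm_of_nonneg (le_max_right _ _)]
      exact max_le (le_abs_self h) (abs_nonneg h)
    refine h.trans_isLittleO ?_
    simpa using Asymptotics.isLittleO_pow_id (𝕜 := ℝ) one_lt_two
  · rw [max_eq_left hx.le]
    have h : HasDerivAt (fun x : ℝ => x ^ 2) (2 * x) x := by simpa using hasDerivAt_pow 2 x
    refine h.congr_of_eventuallyEq ?_
    filter_upwards [lt_mem_nhds hx] with y hy
    rw [max_eq_left hy.le]

theorem weight_bracket_lower_bound {γ X i τ s R m θ : ℝ} (hγ : 0 < γ) (hγ' : γ < 1 / 2)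
    (hX0 : 0 ≤ X) (hX1 : X ≤ 1) (hi : 0 < i) (hτ : 0 < τ) (hsi : s * i = 1 - τ * i) (hs : 0 ≤ s)
    (hR : 0 < R) (h3 : 0 ≤ m) (h4 : m ≤ 1) (hθ : 0 ≤ θ) (hθX : θ ≤ γ * X / 2) :
    τ * i ^ 2 * m ^ 4 ≤ i * m ^ 4 * (1 + X) *
        ((1 - θ) * (1 + X) + (1 + θ) * (2 * γ * X - 1 - X) * (1 - τ * i)) ∧
      4 * ((1 + θ) * ((1 - τ * i) * ((1 + X) ^ 2 * (m ^ 3 * (1 / R))))) ≤ 32 / R := by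
  have hγX0 : 0 ≤ γ * X := by positivity
  have hγX : γ * X ≤ X / 2 := by nlinarith
  have hθ1 : θ ≤ 1 := by linarith
  have f1 : 0 ≤ τ * i := by positivity
  have hτi : 0 ≤ 1 - τ * i := hsi ▸ by positivity
  constructor
  · have hA : τ * i ≤ (1 - θ) * (1 + X) + (1 + θ) * (2 * γ * X - 1 - X) * (1 - τ * i) := by
      have f2 : 0 ≤ (1 - θ) * (1 + X) + (1 + θ) * (2 * γ * X - 1 - X) := by
        have g1 : θ * X ≤ θ := mul_le_of_le_one_right hθ hX1
        have g2 : 0 ≤ θ * (γ * X) := by positivity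
        linarith
      have f3 : 1 ≤ (1 + θ) * (1 + X - 2 * γ * X) :=
        one_le_mul_of_one_le_of_one_le (by linarith) (by linarith)
      linarith [mul_le_mul_of_nonneg_left f3 f1]
    have f4 : 0 ≤ i * m ^ 4 := by positivity
    calc τ * i ^ 2 * m ^ 4 = i * m ^ 4 * 1 * (τ * i) := by ring
      _ ≤ _ := mul_le_mul (mul_le_mul_of_nonneg_left (by linarith) f4) hA f1 (by positivity)
  · have f2 : m ^ 3 ≤ 1 := pow_le_one₀ h3 h4
    have f3 : (1 + X) ^ 2 ≤ 4 := by nlinarith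
    calc 4 * ((1 + θ) * ((1 - τ * i) * ((1 + X) ^ 2 * (m ^ 3 * (1 / R)))))
        ≤ 4 * (2 * (1 * (4 * (1 * (1 / R))))) := by
          gcongr <;> linarith
      _ = 32 / R := by ring

/-- The weight used in the monotonicity estimate. -/
theorem exists_weight {C γ : ℝ} (hC : 0 < C) (hγ : 0 < γ) (hγ' : γ < 1 / 2) :
    ∃ R₀ : ℝ, 0 < R₀ ∧ ∀ R τ : ℝ, 0 < R → R ≤ R₀ → 0 < τ → τ ≤ R / 4 →
      ∃ φ φ' : ℝ → ℝ, (∀ s, 0 ≤ s → HasDerivAt φ (φ' s) s) ∧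
        ContinuousOn φ' (Set.Ici 0) ∧ (∀ s, R ≤ s → φ s = 0) ∧
        (∀ s, 0 ≤ s → φ s * φ' s ≤ 0) ∧
        ∀ s, 0 ≤ s → ∀ θ, 0 ≤ θ → θ ≤ C * s ^ γ →
          -(32 / R) ≤ (1 - θ) * φ s ^ 2 + 2 * (1 + θ) * s * (φ s * φ' s) ∧
          (s ≤ τ → 1 / (16 * τ) - 32 / R ≤
            (1 - θ) * φ s ^ 2 + 2 * (1 + θ) * s * (φ s * φ' s)) := by
  set K := 2 * C / γ with hK
  have hK0 : 0 < K := by positivity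
  refine ⟨(1 / K) ^ (1 / γ) / 2, by positivity, fun R τ hR hR0 hτ hτR => ?_⟩
  have hX1 : ∀ t : ℝ, 0 < t → t ≤ 2 * R → K * t ^ γ ≤ 1 := by
    intro t ht htR
    have h1 : t ^ γ ≤ ((1 / K) ^ (1 / γ)) ^ γ :=
      Real.rpow_le_rpow ht.le (by linarith) hγ.le
    rw [← Real.rpow_mul (by positivity), one_div_mul_cancel hγ.ne', Real.rpow_one] at h1
    calc K * t ^ γ ≤ K * (1 / K) := by gcongr
      _ = 1 := by field_simp
  let g : ℝ → ℝ := fun t => t ^ (-(1 / 2) : ℝ) * (1 + K * t ^ γ)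
  let g' : ℝ → ℝ := fun t => t ^ (-(1 / 2) : ℝ) / t * (γ * (K * t ^ γ) - (1 + K * t ^ γ) / 2)
  have hg : ∀ t, 0 < t → HasDerivAt g (g' t) t := by
    intro t ht
    have h1 := Real.hasDerivAt_rpow_const (p := -(1 / 2)) (Or.inl ht.ne')
    have h2 := Real.hasDerivAt_rpow_const (p := γ) (Or.inl ht.ne')
    refine (h1.mul ((h2.const_mul K).const_add 1)).congr_deriv ?_
    simp only [g']
    rw [Real.rpow_sub_one ht.ne', Real.rpow_sub_one ht.ne']
    field_simp
    ring
  let m : ℝ → ℝ := fun s => max (1 - s / R) 0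
  have hχ : ∀ s, HasDerivAt (fun s => m s ^ 2) (2 * m s * (-(1 / R))) s := by
    intro s
    have h1 : HasDerivAt (fun s : ℝ => 1 - s / R) (-(1 / R)) s :=
      ((hasDerivAt_id s).div_const R).const_sub 1
    exact (hasDerivAt_max_zero_sq (1 - s / R)).comp s h1
  have hm0 : ∀ s, R ≤ s → m s = 0 := fun s hs =>
    max_eq_right (by rw [sub_nonpos, one_le_div hR]; exact hs)
  have hmnn : ∀ s, 0 ≤ m s := fun s => le_max_right _ _
  have hgm : ∀ s, 0 ≤ s → s < R → ∃ X i : ℝ, 0 ≤ X ∧ X ≤ 1 ∧ 0 < i ∧ i * (s + τ) = 1 ∧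
      C * s ^ γ ≤ γ * X / 2 ∧ g (s + τ) ^ 2 = (1 + X) ^ 2 * i ∧
      g (s + τ) * g' (s + τ) = i ^ 2 * (1 + X) * (γ * X - (1 + X) / 2) := by
    intro s hs hsR
    have ht : 0 < s + τ := by linarith
    have hG : ((s + τ) ^ (-(1 / 2) : ℝ)) ^ 2 = (s + τ)⁻¹ := by
      rw [← Real.rpow_natCast, ← Real.rpow_mul ht.le]
      norm_num [Real.rpow_neg_one]
    refine ⟨K * (s + τ) ^ γ, (s + τ)⁻¹, by positivity, hX1 _ ht (by linarith), by positivity,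
      inv_mul_cancel₀ ht.ne', ?_, ?_, ?_⟩
    · have h1 : s ^ γ ≤ (s + τ) ^ γ := Real.rpow_le_rpow hs (by linarith) hγ.le
      calc C * s ^ γ ≤ C * (s + τ) ^ γ := by gcongr
        _ = γ * (K * (s + τ) ^ γ) / 2 := by rw [hK]; field_simp
    · simp only [g]
      rw [mul_pow, hG, mul_comm]
    · simp only [g, g']
      linear_combination (s + τ)⁻¹ * (1 + K * (s + τ) ^ γ) *
        (γ * (K * (s + τ) ^ γ) - (1 + K * (s + τ) ^ γ) / 2) * hG
  have hm1 : ∀ s, 0 ≤ s → m s ≤ 1 := fun s hs =>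
    max_le (by rw [sub_le_self_iff]; positivity) zero_le_one
  refine ⟨fun s => g (s + τ) * m s ^ 2,
    fun s => g' (s + τ) * m s ^ 2 + g (s + τ) * (2 * m s * (-(1 / R))),
    fun s hs => ?_, ?_, fun s hs => ?_, fun s hs => ?_, fun s hs θ hθ hθs => ?_⟩
  · exact ((hg (s + τ) (by linarith)).comp_add_const s τ).mul (hχ s)
  · have hne : ∀ s ∈ Set.Ici (0 : ℝ), s + τ ≠ 0 := fun s hs => by
      have : 0 ≤ s := hs
      positivity
    have hrp : ∀ p : ℝ, ContinuousOn (fun s : ℝ => (s + τ) ^ p) (Set.Ici 0) := fun p =>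
      ContinuousOn.rpow_const (by fun_prop) fun s hs => Or.inl (hne s hs)
    have h1 := hrp (-(1 / 2))
    have h2 := hrp γ
    have h3 : ContinuousOn m (Set.Ici 0) := by fun_prop
    have h4 : ContinuousOn (fun s => (s + τ) ^ (-(1 / 2) : ℝ) / (s + τ)) (Set.Ici 0) :=
      h1.div (by fun_prop) hne
    simp only [g, g']
    fun_prop
  · simp [hm0 s hs]
  · rcases le_or_gt R s with hRs | hRs
    · simp [hm0 s hRs]
    obtain ⟨X, i, hX0, hX1, hi, -, -, e1, e2⟩ := hgm s hs hRs
    have h1 : γ * X - (1 + X) / 2 ≤ 0 := by nlinarith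
    have h2 : g (s + τ) * m s ^ 2 *
        (g' (s + τ) * m s ^ 2 + g (s + τ) * (2 * m s * (-(1 / R)))) =
        (i ^ 2 * (1 + X) * m s ^ 4) * (γ * X - (1 + X) / 2) -
          2 * ((1 + X) ^ 2 * i) * m s ^ 3 * (1 / R) := by
      linear_combination m s ^ 4 * e2 - 2 * m s ^ 3 * (1 / R) * e1
    rw [h2]
    have h3 := hmnn s
    have h4 : (i ^ 2 * (1 + X) * m s ^ 4) * (γ * X - (1 + X) / 2) ≤ 0 :=
      mul_nonpos_of_nonneg_of_nonpos (by positivity) h1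
    have h5 : 0 ≤ 2 * ((1 + X) ^ 2 * i) * m s ^ 3 * (1 / R) := by positivity
    linarith
  · rcases le_or_gt R s with hRs | hRs
    · simp only [hm0 s hRs]
      have : 0 < 32 / R := by positivity
      refine ⟨by norm_num; positivity, fun h => by linarith⟩
    obtain ⟨X, i, hX0, hX1, hi, hit, hθX, e1, e2⟩ := hgm s hs hRs
    have hsi : s * i = 1 - τ * i := by linarith
    obtain ⟨h5, h6⟩ := weight_bracket_lower_bound hγ hγ' hX0 hX1 hi hτ hsi hs hR (hmnn s)
      (hm1 s hs) hθ (hθs.trans hθX)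
    have h2 : (1 - θ) * (g (s + τ) * m s ^ 2) ^ 2 + 2 * (1 + θ) * s * (g (s + τ) * m s ^ 2 *
        (g' (s + τ) * m s ^ 2 + g (s + τ) * (2 * m s * (-(1 / R))))) =
        i * m s ^ 4 * (1 + X) *
          ((1 - θ) * (1 + X) + (1 + θ) * (2 * γ * X - 1 - X) * (1 - τ * i)) -
        4 * ((1 + θ) * ((1 - τ * i) * ((1 + X) ^ 2 * (m s ^ 3 * (1 / R))))) := by
      linear_combination (1 - θ) * m s ^ 4 * e1 + 2 * (1 + θ) * s * m s ^ 4 * e2 -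
        4 * (1 + θ) * s * m s ^ 3 * (1 / R) * e1 +
        (2 * (1 + θ) * m s ^ 4 * i * (1 + X) * (γ * X - (1 + X) / 2) -
          4 * (1 + θ) * m s ^ 3 * (1 / R) * (1 + X) ^ 2) * hsi
    rw [h2]
    refine ⟨by linarith [show 0 ≤ τ * i ^ 2 * m s ^ 4 by positivity], fun hsτ => ?_⟩
    have h5 : 1 / (16 * τ) ≤ τ * i ^ 2 * m s ^ 4 := by
      have f1 : 1 / (2 * τ) ≤ i := by
        rw [div_le_iff₀ (by positivity), ← hit]
        exact mul_le_mul_of_nonneg_left (by linarith) hi.le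
      have f2 : 3 / 4 ≤ m s := by
        refine le_trans ?_ (le_max_left _ _)
        have : s / R ≤ 1 / 4 := by rw [div_le_iff₀ hR]; linarith
        linarith
      have f3 : (1 : ℝ) / 4 ≤ m s ^ 4 := by
        refine le_trans ?_ (pow_le_pow_left₀ (by norm_num) f2 4)
        norm_num
      calc 1 / (16 * τ) = τ * (1 / (2 * τ)) ^ 2 * (1 / 4) := by field_simp; norm_num
        _ ≤ _ := by gcongr
    linarith

end Weight

section Monotonicity

variable {V : Type*} [NormedAddCommGroup V] [NormedSpace ℝ V] [CompleteSpace V]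
  [MeasurableSpace V] [BorelSpace V] [SecondCountableTopology V]

set_option maxHeartbeats 400000 in
/-- Stokes' theorem for the radially weighted map `φ(|u - p|²) (u - p)`, which vanishes near the
boundary of the domain. -/
theorem IsHermitianForm.setIntegral_weighted_nonpos {B : V →L[ℝ] V →L[ℝ] ℝ} {J : V →L[ℝ] V}
    {N Λ : ℝ} (h : IsHermitianForm B J N Λ) {φ φ' : ℝ → ℝ}
    (hφ : ∀ s, 0 ≤ s → HasDerivAt φ (φ' s) s) (hφ' : ContinuousOn φ' (Set.Ici 0)) {R δ : ℝ}
    (hφR : ∀ s, R ≤ s → φ s = 0) (hδ : 0 < δ) (hRδ : R < δ ^ 2) {u : ℂ → V} {Ω : Set ℂ}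
    (hΩ : IsOpen Ω) (hc : IsCompact (closure Ω)) (hu : ∀ z ∈ closure Ω, DifferentiableAt ℝ u z)
    {p : V} (hp : ∀ z ∈ frontier Ω, δ ≤ ‖u z - p‖)
    (hx : MemLp (fun z => fderiv ℝ u z 1) 2 (volume.restrict Ω))
    (hy : MemLp (fun z => fderiv ℝ u z Complex.I) 2 (volume.restrict Ω)) {s f : ℂ → ℝ}
    (hs : ∀ z, s z = B (u z - p) (u z - p))
    (hf : ∀ z, f z = φ (s z) ^ 2 * B (J (fderiv ℝ u z 1)) (fderiv ℝ u z Complex.I) +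
      2 * (φ (s z) * φ' (s z)) *
        (B (u z - p) (fderiv ℝ u z 1) * B (J (u z - p)) (fderiv ℝ u z Complex.I) -
          B (u z - p) (fderiv ℝ u z Complex.I) * B (J (u z - p)) (fderiv ℝ u z 1))) :
    IntegrableOn f Ω ∧ ∫ z in Ω, f z ≤ 0 := by
  have hs0 : ∀ z, 0 ≤ s z := fun z => by rw [hs]; exact h.nonneg _
  set F : ℂ → V := Ω.indicator fun z => φ (s z) • (u z - p) with hF
  have huc : ContinuousOn u (closure Ω) := fun z hz =>
    (hu z hz).continuousAt.continuousWithinAt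
  have hFΩ : ∀ z ∈ Ω, F =ᶠ[nhds z] fun z => φ (s z) • (u z - p) := fun z hz => by
    filter_upwards [hΩ.mem_nhds hz] with y hy
    exact Set.indicator_of_mem hy _
  have hFc : ∀ z ∉ Ω, F =ᶠ[nhds z] fun _ => 0 := by
    intro z hz
    by_cases hzc : z ∈ closure Ω
    · have hzf : z ∈ frontier Ω := by rw [hΩ.frontier_eq]; exact ⟨hzc, hz⟩
      have hcont : ContinuousAt (fun z => ‖u z - p‖ ^ 2) z :=
        ((hu z hzc).continuousAt.sub continuousAt_const).norm.pow 2
      have hlt : R < ‖u z - p‖ ^ 2 :=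
        hRδ.trans_le (pow_le_pow_left₀ hδ.le (hp z hzf) 2)
      filter_upwards [hcont.eventually (lt_mem_nhds hlt)] with y hy
      refine Set.indicator_apply_eq_zero.2 fun _ => ?_
      rw [hφR, zero_smul]
      rw [hs]
      exact hy.le.trans (h.sq_norm_le _)
    · filter_upwards [isClosed_closure.isOpen_compl.mem_nhds hzc] with y hy
      exact Set.indicator_of_notMem (fun hy' => hy (subset_closure hy')) _
  have hder : ∀ z ∈ Ω, ∀ L : ℂ →L[ℝ] V, HasFDerivAt u L z → HasFDerivAt F
      (φ (s z) • L + ((2 * φ' (s z)) • (B (u z - p)).comp L).smulRight (u z - p)) z := by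
    intro z hz L hL
    have h1 : HasFDerivAt (fun z => u z - p) L z := hL.sub_const p
    have h2 : HasFDerivAt s ((2 : ℝ) • (B (u z - p)).comp L) z := by
      have h3 := B.hasFDerivAt_of_bilinear h1 h1
      have h4 : s = fun z => B (u z - p) (u z - p) := funext hs
      rw [h4]
      refine h3.congr_fderiv ?_
      ext v
      simp [ContinuousLinearMap.precompR, ContinuousLinearMap.precompL, h.symm (L v), two_mul]
    have h5 : HasFDerivAt (fun z => φ (s z)) (φ' (s z) • ((2 : ℝ) • (B (u z - p)).comp L)) z :=
      (hφ (s z) (hs0 z)).comp_hasFDerivAt z h2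
    refine ((h5.smul h1).congr_of_eventuallyEq (hFΩ z hz)).congr_fderiv ?_
    ext v
    simp [smul_smul, mul_comm]
  have hdF : Differentiable ℝ F := fun z => by
    by_cases hz : z ∈ Ω
    · exact (hder z hz _ (hu z (subset_closure hz)).hasFDerivAt).differentiableAt
    · exact (differentiableAt_const (0 : V)).congr_of_eventuallyEq (hFc z hz)
  have hfd : ∀ z ∈ Ω, ∀ v, fderiv ℝ F z v = φ (s z) • fderiv ℝ u z v +
      (2 * φ' (s z) * B (u z - p) (fderiv ℝ u z v)) • (u z - p) := by
    intro z hz v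
    rw [(hder z hz _ (hu z (subset_closure hz)).hasFDerivAt).fderiv]
    simp
  have hfd0 : ∀ z ∉ Ω, fderiv ℝ F z = 0 := fun z hz => by
    rw [(hFc z hz).fderiv_eq, fderiv_fun_const]; rfl
  have hcs : HasCompactSupport F := HasCompactSupport.intro hc fun z hz =>
    Set.indicator_of_notMem (fun hz' => hz (subset_closure hz')) _
  have hscont : ContinuousOn s (closure Ω) := by
    have : ContinuousOn (fun z => B (u z - p) (u z - p)) (closure Ω) := by fun_prop
    exact this.congr fun z _ => hs z
  have hφc : ContinuousOn φ (Set.Ici 0) := fun s hs => (hφ s hs).continuousAt.continuousWithinAt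
  obtain ⟨C₁, hC₁⟩ := hc.exists_bound_of_continuousOn
    (hφc.comp hscont fun z _ => hs0 z)
  obtain ⟨C₂, hC₂⟩ := hc.exists_bound_of_continuousOn
    (hφ'.comp hscont fun z _ => hs0 z)
  obtain ⟨C₃, hC₃⟩ := hc.exists_bound_of_continuousOn
    (f := fun z => u z - p) (by fun_prop)
  have hLp : ∀ v, MemLp (fun z => fderiv ℝ u z v) 2 (volume.restrict Ω) →
      MemLp (fun z => fderiv ℝ F z v) 2 := by
    intro v hv
    have hv' : MemLp (Ω.indicator fun z => fderiv ℝ u z v) 2 volume :=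
      (memLp_indicator_iff_restrict hΩ.measurableSet).2 hv
    refine hv'.of_le_mul (c := C₁ + 2 * C₂ * (Λ * C₃) * C₃)
      (measurable_fderiv_apply_const ℝ F v).aestronglyMeasurable (ae_of_all _ fun z => ?_)
    by_cases hz : z ∈ Ω
    · rw [Set.indicator_of_mem hz, hfd z hz]
      have hz' := subset_closure hz
      have g1 : |φ (s z)| ≤ C₁ := hC₁ z hz'
      have g2 : |φ' (s z)| ≤ C₂ := hC₂ z hz'
      have g3 : ‖u z - p‖ ≤ C₃ := hC₃ z hz'
      have hC₂0 := (abs_nonneg _).trans g2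
      have hC₃0 := (norm_nonneg _).trans g3
      have hΛ := h.one_le_Λ
      have g4 : |B (u z - p) (fderiv ℝ u z v)| ≤ Λ * C₃ * ‖fderiv ℝ u z v‖ :=
        (h.abs_apply_le _ _).trans (by gcongr)
      refine (norm_add_le _ _).trans ?_
      rw [norm_smul, norm_smul, norm_mul, norm_mul, Real.norm_eq_abs, Real.norm_eq_abs,
        Real.norm_eq_abs, Real.norm_eq_abs, abs_two]
      calc _ ≤ C₁ * ‖fderiv ℝ u z v‖ + 2 * C₂ * (Λ * C₃ * ‖fderiv ℝ u z v‖) * C₃ := by gcongr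
        _ = _ := by ring
    · simp [hfd0 z hz, hz]
  have hω : ∀ a b, (B.comp J) a b = -(B.comp J) b a := fun a b => h.form_antisymm a b
  have hst := integral_form_fderiv_nonpos hdF hcs (hLp 1 hx) (hLp Complex.I hy) (B.comp J) hω
  have hInt := integrable_bilin_of_memLp_two (B.comp J) (hLp 1 hx) (hLp Complex.I hy)
  have hfF : ∀ z ∈ Ω, (B.comp J) (fderiv ℝ F z 1) (fderiv ℝ F z Complex.I) = f z := by
    intro z hz
    have h0 : B (J (u z - p)) (u z - p) = 0 := by
      have := h.form_antisymm (u z - p) (u z - p)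
      linarith
    have h1 := h.form_antisymm (fderiv ℝ u z 1) (u z - p)
    rw [hfd z hz, hfd z hz, hf]
    simp only [ContinuousLinearMap.comp_apply, map_add, map_smul, add_apply, smul_apply,
      smul_eq_mul, h0, h1]
    ring
  refine ⟨hInt.integrableOn.congr_fun hfF hΩ.measurableSet, ?_⟩
  rw [← setIntegral_congr_fun hΩ.measurableSet hfF,
    setIntegral_eq_integral_of_forall_compl_eq_zero fun z hz => by simp [hfd0 z hz]]
  exact hst

/-- Monotonicity: a pseudoholomorphic curve whose boundary is at distance at least `δ` from one of
its points has energy bounded below by a constant depending only on `δ` and the bounds on the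
almost complex structure. -/
theorem exists_energy_lower_bound {J : V → V →L[ℝ] V} {N Λ H α δ : ℝ} (hα : 0 < α) (hα1 : α < 1)
    (hH : 0 < H) (hδ : 0 < δ) (hB : ∀ p, ∃ B, IsHermitianForm B (J p) N Λ)
    (hJ : ∀ x x', ‖J x - J x'‖ ≤ H * ‖x - x'‖ ^ α) :
    ∃ c, 0 < c ∧ ∀ (u : ℂ → V) (Ω : Set ℂ), IsOpen Ω → IsCompact (closure Ω) →
      (∀ z ∈ closure Ω, DifferentiableAt ℝ u z) →
      (∀ z ∈ Ω, fderiv ℝ u z Complex.I = J (u z) (fderiv ℝ u z 1)) →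
      IntegrableOn (fun z => ‖fderiv ℝ u z 1‖ ^ 2) Ω →
      ∀ z₁ ∈ Ω, fderiv ℝ u z₁ 1 ≠ 0 → (∀ z ∈ frontier Ω, δ ≤ ‖u z - u z₁‖) →
      c ≤ ∫ z in Ω, ‖fderiv ℝ u z 1‖ ^ 2 := by
  obtain ⟨B₀, h₀⟩ := hB 0
  have hN := h₀.one_le_N
  have hΛ := h₀.one_le_Λ
  obtain ⟨R₀, hR₀, hw⟩ := exists_weight (C := 2 * Λ ^ 2 * N * H) (γ := α / 2) (by positivity)
    (by positivity) (by linarith)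
  set R := min R₀ (δ ^ 2 / 4) with hRdef
  have hR : 0 < R := by positivity
  refine ⟨R / (16 * 16 * 32 * Λ ^ 2 * N ^ 2), by positivity,
    fun u Ω hΩ hc hu heq hInt z₁ hz₁ h1 hfr => ?_⟩
  obtain ⟨B, h⟩ := hB (u z₁)
  have huΩ : ∀ z ∈ Ω, DifferentiableAt ℝ u z := fun z hz => hu z (subset_closure hz)
  have hnorm_eq : ∀ z ∈ Ω, ‖fderiv ℝ u z Complex.I‖ ≤ N * ‖fderiv ℝ u z 1‖ := fun z hz => by
    obtain ⟨_, h'⟩ := hB (u z)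
    rw [heq z hz]
    exact h'.norm_le _
  set ℓ := ‖fderiv ℝ u z₁ 1‖ with hℓ
  have hℓ0 : 0 < ℓ := norm_pos_iff.2 h1
  obtain ⟨ρ, hρ, hρκ, Q, hQΩ, hQm, hQu, hQE⟩ := exists_square_le_lintegral hΩ huΩ hz₁ hN
    (hnorm_eq z₁ hz₁) h1 (κ := √(R / (4 * Λ)) / (4 * N * ℓ)) (by positivity)
  set τ := Λ * (4 * N * ρ * ℓ) ^ 2 with hτdef
  have hτ : 0 < τ := by positivity
  have hτR : τ ≤ R / 4 := by
    rw [lt_div_iff₀ (by positivity)] at hρκ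
    have h2 : 4 * N * ρ * ℓ ≤ √(R / (4 * Λ)) := by linarith
    calc τ ≤ Λ * √(R / (4 * Λ)) ^ 2 := by rw [hτdef]; gcongr
      _ = R / 4 := by rw [Real.sq_sqrt (by positivity)]; field_simp
  obtain ⟨φ, φ', hφ, hφ', hφR, hφφ', hφlow⟩ := hw R τ hR (min_le_left _ _) hτ hτR
  have hxLp : MemLp (fun z => fderiv ℝ u z 1) 2 (volume.restrict Ω) :=
    (memLp_two_iff_integrable_sq_norm
      (measurable_fderiv_apply_const ℝ u 1).aestronglyMeasurable).2 hInt
  have hyLp : MemLp (fun z => fderiv ℝ u z Complex.I) 2 (volume.restrict Ω) :=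
    hxLp.of_le_mul (c := N)
      (measurable_fderiv_apply_const ℝ u Complex.I).aestronglyMeasurable
      ((ae_restrict_mem hΩ.measurableSet).mono hnorm_eq)
  have hRδ : R < δ ^ 2 := by
    have := min_le_right R₀ (δ ^ 2 / 4)
    have : 0 < δ ^ 2 := by positivity
    linarith
  obtain ⟨hfi, hf0⟩ := h.setIntegral_weighted_nonpos hφ hφ' hφR hδ hRδ hΩ hc hu hfr hxLp hyLp
    (fun _ => rfl) (fun _ => rfl)
  have hpt : ∀ z ∈ Ω, Q.indicator (fun z => 1 / (16 * τ) * ‖fderiv ℝ u z 1‖ ^ 2) z -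
      32 / R * Λ * ‖fderiv ℝ u z 1‖ ^ 2 ≤
      φ (B (u z - u z₁) (u z - u z₁)) ^ 2 *
        B (J (u z₁) (fderiv ℝ u z 1)) (fderiv ℝ u z Complex.I) +
      2 * (φ (B (u z - u z₁) (u z - u z₁)) * φ' (B (u z - u z₁) (u z - u z₁))) *
        (B (u z - u z₁) (fderiv ℝ u z 1) * B (J (u z₁) (u z - u z₁)) (fderiv ℝ u z Complex.I) -
          B (u z - u z₁) (fderiv ℝ u z Complex.I) *
            B (J (u z₁) (u z - u z₁)) (fderiv ℝ u z 1)) := by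
    intro z hz
    have hθ : ‖fderiv ℝ u z Complex.I - J (u z₁) (fderiv ℝ u z 1)‖ ≤
        H * ‖u z - u z₁‖ ^ α * ‖fderiv ℝ u z 1‖ := by
      rw [heq z hz, ← sub_apply]
      exact ContinuousLinearMap.le_of_opNorm_le _ (hJ _ _) _
    generalize hvv : fderiv ℝ u z 1 = v at hθ ⊢
    generalize fderiv ℝ u z Complex.I = v' at hθ ⊢
    generalize hww : u z - u z₁ = w at hθ ⊢
    have hP := h.le_form_apply hθ
    have hT := h.mul_sub_mul_le (w := w) hθ
    set s := B w w with hs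
    set e := B v v with he
    have hs0 : 0 ≤ s := h.nonneg w
    have he0 : 0 ≤ e := h.nonneg v
    have hws : ‖w‖ ^ α ≤ s ^ (α / 2) := by
      calc ‖w‖ ^ α = (‖w‖ ^ 2) ^ (α / 2) := by
            rw [← Real.rpow_natCast_mul (norm_nonneg _)]; congr 1; push_cast; ring
        _ ≤ _ := Real.rpow_le_rpow (by positivity) (h.sq_norm_le w) (by positivity)
    obtain ⟨hb1, hb2⟩ := hφlow s hs0 (2 * Λ ^ 2 * N * (H * ‖w‖ ^ α)) (by positivity) (by
      calc 2 * Λ ^ 2 * N * (H * ‖w‖ ^ α) ≤ 2 * Λ ^ 2 * N * (H * s ^ (α / 2)) := by gcongr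
        _ = _ := by ring)
    set ε := 2 * Λ ^ 2 * N * (H * ‖w‖ ^ α) with hε
    have hlow : ((1 - ε) * φ s ^ 2 + 2 * (1 + ε) * s * (φ s * φ' s)) * e ≤
        φ s ^ 2 * B (J (u z₁) v) v' +
          2 * (φ s * φ' s) * (B w v * B (J (u z₁) w) v' - B w v' * B (J (u z₁) w) v) := by
      have g1 := mul_le_mul_of_nonneg_left hP (sq_nonneg (φ s))
      have g2 := mul_le_mul_of_nonpos_left hT
        (show 2 * (φ s * φ' s) ≤ 0 by linarith [hφφ' s hs0])
      linarith
    refine le_trans ?_ hlow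
    have hv1 : ‖v‖ ^ 2 ≤ e := h.sq_norm_le v
    have hv2 : 32 / R * e ≤ 32 / R * (Λ * ‖v‖ ^ 2) := by
      have := h.apply_le v
      gcongr
    by_cases hzQ : z ∈ Q
    · rw [Set.indicator_of_mem hzQ, hvv]
      have hsτ : s ≤ τ := by
        refine (h.apply_le w).trans ?_
        have := hQu z hzQ
        rw [hww] at this
        rw [hτdef]
        gcongr
      have g1 := mul_le_mul_of_nonneg_right (hb2 hsτ) he0
      have g2 : 1 / (16 * τ) * ‖v‖ ^ 2 ≤ 1 / (16 * τ) * e := by gcongr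
      linarith
    · rw [Set.indicator_of_notMem hzQ]
      have g1 := mul_le_mul_of_nonneg_right hb1 he0
      linarith
  have hQi : IntegrableOn (fun z => ‖fderiv ℝ u z 1‖ ^ 2) Q := hInt.mono_set hQΩ
  have hQi' : IntegrableOn (Q.indicator fun z => 1 / (16 * τ) * ‖fderiv ℝ u z 1‖ ^ 2) Ω :=
    ((integrable_indicator_iff hQm).2 (hQi.const_mul _)).integrableOn
  have hle := setIntegral_mono_on (hQi'.sub (hInt.const_mul (32 / R * Λ))) hfi hΩ.measurableSet hpt
  simp only [Pi.sub_apply] at hle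
  rw [integral_sub hQi' (hInt.const_mul _), integral_const_mul, setIntegral_indicator hQm,
    Set.inter_eq_self_of_subset_right hQΩ, integral_const_mul] at hle
  have hQlow : ρ ^ 2 * ℓ ^ 2 ≤ ∫ z in Q, ‖fderiv ℝ u z 1‖ ^ 2 := by
    rw [← ENNReal.ofReal_le_ofReal_iff (integral_nonneg fun z => by positivity),
      ofReal_integral_eq_lintegral_ofReal hQi (ae_of_all _ fun z => by positivity)]
    refine hQE.trans_eq (lintegral_congr fun z => ?_)
    rw [ENNReal.ofReal_pow (norm_nonneg _), ofReal_norm]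
  have hτ2 : ρ ^ 2 * ℓ ^ 2 = τ / (16 * Λ * N ^ 2) := by rw [hτdef]; field_simp; norm_num
  have g1 : 1 / (16 * τ) * (τ / (16 * Λ * N ^ 2)) ≤
      1 / (16 * τ) * ∫ z in Q, ‖fderiv ℝ u z 1‖ ^ 2 := by
    rw [← hτ2]; gcongr
  have g2 : 1 / (16 * τ) * (τ / (16 * Λ * N ^ 2)) = 1 / (16 * 16 * Λ * N ^ 2) := by field_simp
  rw [g2] at g1
  have g3 : 1 / (16 * 16 * Λ * N ^ 2) ≤ 32 / R * Λ * ∫ z in Ω, ‖fderiv ℝ u z 1‖ ^ 2 := by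
    linarith
  calc R / (16 * 16 * 32 * Λ ^ 2 * N ^ 2) = R / (32 * Λ) * (1 / (16 * 16 * Λ * N ^ 2)) := by
        field_simp
    _ ≤ R / (32 * Λ) * (32 / R * Λ * ∫ z in Ω, ‖fderiv ℝ u z 1‖ ^ 2) := by gcongr
    _ = _ := by field_simp

end Monotonicity

section PuncturedDisk

variable {V : Type*} [NormedAddCommGroup V]

/-- The closed circular annulus contains the closure of the open one. -/
theorem closure_annulus_subset (r₁ r₂ : ℝ) :
    closure {z : ℂ | r₁ < ‖z‖ ∧ ‖z‖ < r₂} ⊆ {z : ℂ | r₁ ≤ ‖z‖ ∧ ‖z‖ ≤ r₂} :=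
  closure_minimal (fun _ hz => ⟨hz.1.le, hz.2.le⟩)
    ((isClosed_le continuous_const continuous_norm).inter
      (isClosed_le continuous_norm continuous_const))

theorem isOpen_annulus (r₁ r₂ : ℝ) : IsOpen {z : ℂ | r₁ < ‖z‖ ∧ ‖z‖ < r₂} :=
  (isOpen_lt continuous_const continuous_norm).inter (isOpen_lt continuous_norm continuous_const)

/-- If `u` is nearly constant on the two boundary circles of an annulus, and takes in the annulus
only values close to its boundary values, then it is nearly constant on the annulus. -/
theorem norm_sub_le_of_annulus {u : ℂ → V} {r₁ r₂ η : ℝ} (hr₁ : 0 < r₁) (hr : r₁ ≤ r₂)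
    (hu : ∀ z, r₁ ≤ ‖z‖ → ‖z‖ ≤ r₂ → ContinuousAt u z)
    (h₁ : ∀ z w : ℂ, ‖z‖ = r₁ → ‖w‖ = r₁ → ‖u z - u w‖ ≤ η)
    (h₂ : ∀ z w : ℂ, ‖z‖ = r₂ → ‖w‖ = r₂ → ‖u z - u w‖ ≤ η)
    (hA : ∀ z, r₁ < ‖z‖ → ‖z‖ < r₂ → ∃ w, (‖w‖ = r₁ ∨ ‖w‖ = r₂) ∧ ‖u z - u w‖ ≤ η)
    {z : ℂ} (hz₁ : r₁ ≤ ‖z‖) (hz₂ : ‖z‖ ≤ r₂) : ‖u z - u r₂‖ ≤ 7 * η := by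
  have hn₁ : ‖(r₁ : ℂ)‖ = r₁ := by rw [Complex.norm_real, Real.norm_of_nonneg hr₁.le]
  have hn₂ : ‖(r₂ : ℂ)‖ = r₂ := by rw [Complex.norm_real, Real.norm_of_nonneg (hr₁.le.trans hr)]
  have hη : 0 ≤ η := (norm_nonneg _).trans (h₁ r₁ r₁ hn₁ hn₁)
  have hnear : ∀ z : ℂ, r₁ ≤ ‖z‖ → ‖z‖ ≤ r₂ →
      ‖u z - u r₁‖ ≤ 2 * η ∨ ‖u z - u r₂‖ ≤ 2 * η := by
    intro z hz hz'
    have hw : ∃ w : ℂ, (‖w‖ = r₁ ∨ ‖w‖ = r₂) ∧ ‖u z - u w‖ ≤ η := by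
      rcases hz.eq_or_lt with h | h
      · exact ⟨z, Or.inl h.symm, by simpa using hη⟩
      rcases hz'.eq_or_lt with h' | h'
      · exact ⟨z, Or.inr h', by simpa using hη⟩
      exact hA z h h'
    obtain ⟨w, hw | hw, hzw⟩ := hw
    · left
      have := norm_sub_le_norm_sub_add_norm_sub (u z) (u w) (u r₁)
      linarith [h₁ w r₁ hw hn₁]
    · right
      have := norm_sub_le_norm_sub_add_norm_sub (u z) (u w) (u r₂)
      linarith [h₂ w r₂ hw hn₂]
  have hends : ‖u r₁ - u r₂‖ ≤ 5 * η := by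
    by_contra! hcon
    have hcont : ContinuousOn (fun t : ℝ => ‖u t - u r₂‖) (Set.Icc r₁ r₂) := by
      intro t ht
      have hnt : ‖(t : ℂ)‖ = t := by
        rw [Complex.norm_real, Real.norm_of_nonneg (hr₁.le.trans ht.1)]
      have h1 : ContinuousAt (fun t : ℝ => u t) t :=
        (hu t (by rw [hnt]; exact ht.1) (by rw [hnt]; exact ht.2)).comp
          (f := fun t : ℝ => (t : ℂ)) Complex.continuous_ofReal.continuousAt
      exact (h1.sub continuousAt_const).norm.continuousWithinAt
    obtain ⟨t, ht, hteq⟩ := intermediate_value_Icc' hr hcont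
      (show ‖u r₁ - u r₂‖ / 2 ∈ _ from ⟨by simp; positivity, by linarith⟩)
    have hnt : ‖(t : ℂ)‖ = t := by
      rw [Complex.norm_real, Real.norm_of_nonneg (hr₁.le.trans ht.1)]
    simp only at hteq
    rcases hnear t (by rw [hnt]; exact ht.1) (by rw [hnt]; exact ht.2) with h | h
    · have := norm_sub_le_norm_sub_add_norm_sub (u r₁) (u t) (u r₂)
      rw [norm_sub_rev (u r₁) (u t)] at this
      linarith
    · linarith
  rcases hnear z hz₁ hz₂ with h | h
  · have := norm_sub_le_norm_sub_add_norm_sub (u z) (u r₁) (u r₂)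
    linarith
  · linarith

variable [NormedSpace ℝ V]

/-- If `u` takes a value far from its values on the outer circle, then it has nonzero derivative at
some point where it takes a nearby value. -/
theorem exists_norm_sub_lt_and_fderiv_ne_zero {u : ℂ → V} {r₁ r₂ δ : ℝ} (hr₁ : 0 ≤ r₁)
    (hδ : 0 < δ) {z₀ : ℂ} (hz₁ : r₁ < ‖z₀‖) (hz₂ : ‖z₀‖ < r₂)
    (hu : ∀ z, r₁ < ‖z‖ → ‖z‖ ≤ r₂ → DifferentiableAt ℝ u z)
    (hfr : ∀ z, ‖z‖ = r₂ → δ ≤ ‖u z - u z₀‖) :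
    ∃ z₁, r₁ < ‖z₁‖ ∧ ‖z₁‖ < r₂ ∧ ‖u z₁ - u z₀‖ < δ ∧ fderiv ℝ u z₁ ≠ 0 := by
  by_contra! hcon
  have hz0 : 0 < ‖z₀‖ := hr₁.trans_lt hz₁
  set T := r₂ / ‖z₀‖ with hT
  have hT1 : 1 < T := (one_lt_div hz0).2 hz₂
  have hn : ∀ t : ℝ, 1 ≤ t → ‖(t : ℂ) * z₀‖ = t * ‖z₀‖ := fun t ht => by
    rw [norm_mul, Complex.norm_real, Real.norm_of_nonneg (by linarith)]
  have hlo : ∀ t : ℝ, 1 ≤ t → r₁ < ‖(t : ℂ) * z₀‖ := fun t ht => by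
    rw [hn t ht]; nlinarith
  have hd : ∀ t ∈ Set.Icc 1 T,
      HasDerivAt (fun t : ℝ => u (t * z₀) - u z₀) (fderiv ℝ u (t * z₀) z₀) t := by
    intro t ht
    have h1 : HasDerivAt (fun t : ℝ => (t : ℂ) * z₀) z₀ t := by
      simpa using (Complex.ofRealCLM.hasDerivAt (x := t)).mul_const z₀
    refine ((hu _ (hlo t ht.1) ?_).hasFDerivAt.comp_hasDerivAt t h1).sub_const _
    rw [hn t ht.1, ← le_div_iff₀ hz0]
    exact ht.2
  have hBd : ∀ t : ℝ, HasDerivAt (fun t : ℝ => δ / 2 * ((t - 1) / (T - 1)))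
      (δ / 2 * (1 / (T - 1))) t := fun t =>
    (((hasDerivAt_id t).sub_const 1).div_const (T - 1)).const_mul (δ / 2)
  have hle := image_norm_le_of_norm_deriv_right_lt_deriv_boundary'
    (f := fun t : ℝ => u (t * z₀) - u z₀) (a := 1) (b := T)
    (fun t ht => (hd t ht).continuousAt.continuousWithinAt)
    (fun t ht => (hd t (Set.Ico_subset_Icc_self ht)).hasDerivWithinAt)
    (B := fun t => δ / 2 * ((t - 1) / (T - 1))) (by simp)
    (fun t _ => (hBd t).continuousAt.continuousWithinAt)
    (fun t _ => (hBd t).hasDerivWithinAt)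
    (fun t ht heq => by
      have hlt : δ / 2 * ((t - 1) / (T - 1)) < δ := by
        have : (t - 1) / (T - 1) < 1 := by
          rw [div_lt_one (by linarith)]; linarith [ht.2]
        nlinarith
      rw [hcon _ (hlo t ht.1) (by
        rw [hn t ht.1, ← lt_div_iff₀ hz0]; exact ht.2) (heq.trans_lt hlt)]
      have : 0 < T - 1 := by linarith
      simp only [zero_apply, norm_zero]
      positivity)
    (Set.right_mem_Icc.2 hT1.le)
  have h1 := hfr (T * z₀) (by rw [hn T hT1.le, hT]; field_simp)
  have h2 : (T - 1) / (T - 1) = 1 := div_self (by linarith)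
  simp only [h2] at hle
  linarith

variable [CompleteSpace V] [MeasurableSpace V] [BorelSpace V] [SecondCountableTopology V]

theorem exists_tendsto_of_finite_energy {J : V → V →L[ℝ] V} {N Λ H α : ℝ} (hα : 0 < α)
    (hα1 : α < 1) (hH : 0 < H) (hB : ∀ p, ∃ B, IsHermitianForm B (J p) N Λ)
    (hJ : ∀ x x', ‖J x - J x'‖ ≤ H * ‖x - x'‖ ^ α) {u : ℂ → V}
    (hu : ∀ z ∈ Metric.ball (0 : ℂ) 1 \ {0}, DifferentiableAt ℝ u z)
    (heq : ∀ z ∈ Metric.ball (0 : ℂ) 1 \ {0}, fderiv ℝ u z Complex.I = J (u z) (fderiv ℝ u z 1))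
    (hE : IntegrableOn (fun z => ‖fderiv ℝ u z 1‖ ^ 2) (Metric.ball (0 : ℂ) 1 \ {0})) :
    ∃ L, Filter.Tendsto u (nhdsWithin 0 {0}ᶜ) (nhds L) := by
  obtain ⟨B₀, h₀⟩ := hB 0
  have hN := h₀.one_le_N
  have hmem : ∀ z : ℂ, 0 < ‖z‖ → ‖z‖ < 1 → z ∈ Metric.ball (0 : ℂ) 1 \ {0} := fun z h h' =>
    ⟨by simpa using h', by simpa using norm_pos_iff.1 h⟩
  have hset : MeasurableSet (Metric.ball (0 : ℂ) 1 \ {0}) :=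
    measurableSet_ball.diff (measurableSet_singleton 0)
  have hnorm_le : ∀ z ∈ Metric.ball (0 : ℂ) 1 \ {0},
      ‖fderiv ℝ u z‖ ≤ (1 + N) * ‖fderiv ℝ u z 1‖ := by
    intro z hz
    obtain ⟨_, h'⟩ := hB (u z)
    refine ContinuousLinearMap.opNorm_le_bound _ (by positivity) fun ζ => ?_
    rw [clm_apply_eq_re_smul_add_im_smul, heq z hz]
    refine (norm_add_le _ _).trans ?_
    rw [norm_smul, norm_smul, Real.norm_eq_abs, Real.norm_eq_abs]
    calc _ ≤ ‖ζ‖ * ‖fderiv ℝ u z 1‖ + ‖ζ‖ * (N * ‖fderiv ℝ u z 1‖) := by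
          gcongr
          exacts [Complex.abs_re_le_norm ζ, Complex.abs_im_le_norm ζ, h'.norm_le _]
      _ = _ := by ring
  have hE' : ∫⁻ z in Metric.ball (0 : ℂ) 1 \ {0}, ‖fderiv ℝ u z‖ₑ ^ 2 ≠ ⊤ := by
    refine ne_top_of_le_ne_top (hE.const_mul ((1 + N) ^ 2)).lintegral_lt_top.ne
      (setLIntegral_mono' hset fun z hz => ?_)
    rw [← ofReal_norm, ← ENNReal.ofReal_pow (norm_nonneg _), ← mul_pow]
    exact ENNReal.ofReal_le_ofReal (pow_le_pow_left₀ (norm_nonneg _) (hnorm_le z hz) 2)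
  rw [← cauchy_map_iff_exists_tendsto, Metric.cauchy_iff]
  refine ⟨inferInstance, fun ε hε => ?_⟩
  set η := ε / 16 with hη
  have hη0 : 0 < η := by positivity
  obtain ⟨c, hc, hmono⟩ := exists_energy_lower_bound hα hα1 hH (half_pos hη0) hB hJ
  obtain ⟨ρ, hρ, hρ1, hsmall⟩ : ∃ ρ, 0 < ρ ∧ ρ ≤ 1 ∧
      ∫ z in Metric.ball (0 : ℂ) ρ \ {0}, ‖fderiv ℝ u z 1‖ ^ 2 < c := by
    have h1 : Filter.Tendsto (fun ρ : ℝ => volume (Metric.ball (0 : ℂ) ρ \ {0}))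
        (nhdsWithin 0 (Set.Ioi 0)) (nhds 0) := by
      have h2 : Filter.Tendsto (fun ρ : ℝ => volume (Metric.ball (0 : ℂ) ρ))
          (nhdsWithin 0 (Set.Ioi 0)) (nhds 0) := by
        simp only [Complex.volume_ball]
        have h3 : Filter.Tendsto (fun ρ : ℝ => ENNReal.ofReal (ρ ^ 2 * Real.pi)) (nhds 0)
            (nhds (ENNReal.ofReal (0 ^ 2 * Real.pi))) :=
          ENNReal.tendsto_ofReal (Continuous.tendsto (by fun_prop) 0)
        simp only [ne_eq, OfNat.ofNat_ne_zero, not_false_eq_true, zero_pow, zero_mul,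
          ENNReal.ofReal_zero] at h3
        refine (h3.mono_left nhdsWithin_le_nhds).congr' ?_
        filter_upwards [self_mem_nhdsWithin] with ρ hρ
        have hρ0 : 0 ≤ ρ := le_of_lt hρ
        rw [ENNReal.ofReal_mul (by positivity), ENNReal.ofReal_pow hρ0]
        congr 1
        exact ENNReal.ofReal_coe_nnreal (p := NNReal.pi)
      exact tendsto_of_tendsto_of_tendsto_of_le_of_le tendsto_const_nhds h2
        (fun _ => zero_le) fun ρ => measure_mono Set.sdiff_subset
    have h4 := Integrable.tendsto_setIntegral_nhds_zero hE
      (s := fun ρ : ℝ => Metric.ball (0 : ℂ) ρ \ {0})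
      (tendsto_of_tendsto_of_tendsto_of_le_of_le tendsto_const_nhds h1
        (fun _ => zero_le) fun ρ => Measure.restrict_apply_le _ _)
    obtain ⟨ρ, hρ, hρ0, hρ1⟩ := ((h4.eventually (gt_mem_nhds hc)).and
      (Ioo_mem_nhdsGT one_pos)).exists
    refine ⟨ρ, hρ0, hρ1.le, ?_⟩
    rwa [Measure.restrict_restrict (measurableSet_ball.diff (measurableSet_singleton 0)),
      Set.inter_eq_self_of_subset_left
        (Set.sdiff_subset_sdiff_left (Metric.ball_subset_ball hρ1.le))] at hρ
  obtain ⟨r₂, ⟨hr₂, hr₂ρ⟩, h₂⟩ := exists_circle_oscillation_le hu hE' hη0 hρ hρ1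
  have hbound : ∀ z : ℂ, 0 < ‖z‖ → ‖z‖ < r₂ → ‖u z - u r₂‖ ≤ 7 * η := by
    intro z hz hz'
    obtain ⟨r₁, ⟨hr₁, hr₁z⟩, h₁⟩ := exists_circle_oscillation_le hu hE' hη0 hz (by linarith)
    refine norm_sub_le_of_annulus hr₁ (by linarith)
      (fun w hw hw' => (hu w (hmem w (by linarith) (by linarith))).continuousAt) h₁ h₂
      (fun z₀ hz₁ hz₂ => ?_) hr₁z.le hz'.le
    by_contra! hcon
    obtain ⟨z₁, hz₁l, hz₁r, hz₁n, hz₁d⟩ := exists_norm_sub_lt_and_fderiv_ne_zero hr₁.le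
      (half_pos hη0) hz₁ hz₂
      (fun w hw hw' => hu w (hmem w (by linarith) (by linarith)))
      (fun w hw => by
        rw [norm_sub_rev]
        linarith [hcon w (Or.inr hw)])
    have hmemA : ∀ w ∈ {z : ℂ | r₁ < ‖z‖ ∧ ‖z‖ < r₂}, w ∈ Metric.ball (0 : ℂ) 1 \ {0} :=
      fun w hw => hmem w (hr₁.trans hw.1) (by linarith [hw.2])
    have hsub : {z : ℂ | r₁ < ‖z‖ ∧ ‖z‖ < r₂} ⊆ Metric.ball (0 : ℂ) ρ \ {0} := fun w hw =>
      ⟨by simpa using hw.2.trans hr₂ρ, (hmemA w hw).2⟩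
    have hle := hmono u {z : ℂ | r₁ < ‖z‖ ∧ ‖z‖ < r₂} (isOpen_annulus r₁ r₂)
      ((isCompact_closedBall (0 : ℂ) r₂).of_isClosed_subset isClosed_closure
        ((closure_annulus_subset r₁ r₂).trans fun w hw => by simpa using hw.2))
      (fun w hw => hu w (hmem w (hr₁.trans_le (closure_annulus_subset r₁ r₂ hw).1)
        (by linarith [(closure_annulus_subset r₁ r₂ hw).2])))
      (fun w hw => heq w (hmemA w hw)) (hE.mono_set hmemA) z₁ ⟨hz₁l, hz₁r⟩
      (fun h0 => hz₁d (by
        have := hnorm_le z₁ (hmemA z₁ ⟨hz₁l, hz₁r⟩)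
        rw [h0, norm_zero, mul_zero] at this
        exact norm_le_zero_iff.1 this))
      (fun w hw => by
        rw [(isOpen_annulus r₁ r₂).frontier_eq] at hw
        have hwc := closure_annulus_subset r₁ r₂ hw.1
        have hw' : ‖w‖ = r₁ ∨ ‖w‖ = r₂ := by
          by_contra! hne
          exact hw.2 ⟨hwc.1.lt_of_ne' hne.1, hwc.2.lt_of_ne hne.2⟩
        have h5 := hcon w hw'
        have h6 := norm_sub_le_norm_sub_add_norm_sub (u z₀) (u z₁) (u w)
        rw [norm_sub_rev (u z₀) (u z₁), norm_sub_rev (u z₁) (u w)] at h6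
        linarith)
    have hmonoE : ∫ w in {z : ℂ | r₁ < ‖z‖ ∧ ‖z‖ < r₂}, ‖fderiv ℝ u w 1‖ ^ 2 ≤
        ∫ w in Metric.ball (0 : ℂ) ρ \ {0}, ‖fderiv ℝ u w 1‖ ^ 2 :=
      setIntegral_mono_set (hE.mono_set
        (Set.sdiff_subset_sdiff_left (Metric.ball_subset_ball hρ1)))
        (ae_of_all _ fun w => by simp only [Pi.zero_apply]; positivity) hsub.eventuallyLE
    linarith
  refine ⟨Set.image u (Metric.ball 0 r₂ ∩ {0}ᶜ), Filter.image_mem_map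
    (Filter.inter_mem (mem_nhdsWithin_of_mem_nhds (Metric.ball_mem_nhds 0 hr₂))
      self_mem_nhdsWithin), ?_⟩
  rintro _ ⟨z, ⟨hz, hz0⟩, rfl⟩ _ ⟨w, ⟨hw, hw0⟩, rfl⟩
  have h7 := hbound z (norm_pos_iff.2 hz0) (by simpa using hz)
  have h8 := hbound w (norm_pos_iff.2 hw0) (by simpa using hw)
  have h9 := norm_sub_le_norm_sub_add_norm_sub (u z) (u r₂) (u w)
  rw [norm_sub_rev (u r₂)] at h9
  rw [dist_eq_norm]
  linarith

end PuncturedDisk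

/-- removal of interior point singularities (part 1 of
Theorem 2.7, in a coordinate chart).  A bounded finite-energy pseudoholomorphic
map on the punctured disk extends continuously over the puncture. -/
theorem removal_of_interior_singularity (n : ℕ) (hn : 1 ≤ n)
    (α : ℝ) (hα : α ∈ Set.Ioo (0 : ℝ) 1)
    (J : (Fin n → ℂ) → ((Fin n → ℂ) →L[ℝ] (Fin n → ℂ))) (MJ HJ : ℝ)
    (hJbd : ∀ x, ‖J x‖ ≤ MJ)
    (hJhol : ∀ x x', ‖J x - J x'‖ ≤ HJ * ‖x - x'‖ ^ α)
    (hJsq : ∀ x v, J x (J x v) = -v)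
    (u : ℂ → (Fin n → ℂ)) (M : ℝ)
    (hdiff : ∀ z ∈ Metric.ball (0 : ℂ) 1 \ {0}, DifferentiableAt ℝ u z)
    (heq : ∀ z ∈ Metric.ball (0 : ℂ) 1 \ {0},
      fderiv ℝ u z 1 + J (u z) (fderiv ℝ u z Complex.I) = 0)
    (hbd : ∀ z ∈ Metric.ball (0 : ℂ) 1 \ {0}, ‖u z‖ ≤ M)
    (hE : IntegrableOn
      (fun z => ‖fderiv ℝ u z 1‖ ^ 2 + ‖fderiv ℝ u z Complex.I‖ ^ 2)
      (Metric.ball (0 : ℂ) 1 \ {0})) :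
    ∃ v : ℂ → (Fin n → ℂ), ContinuousOn v (Metric.ball (0 : ℂ) 1) ∧
      ∀ z ∈ Metric.ball (0 : ℂ) 1 \ {0}, v z = u z := by
  obtain ⟨Λ, hΛ⟩ := exists_isHermitianForm (n := n) (le_max_right MJ 1)
  have hB : ∀ p, ∃ B, IsHermitianForm B (J p) (max MJ 1) Λ := fun p =>
    hΛ (J p) ((hJbd p).trans (le_max_left _ _)) (hJsq p)
  have hJ : ∀ x x', ‖J x - J x'‖ ≤ max HJ 1 * ‖x - x'‖ ^ α := fun x x' =>
    (hJhol x x').trans (mul_le_mul_of_nonneg_right (le_max_left _ _) (by positivity))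
  have heq' : ∀ z ∈ Metric.ball (0 : ℂ) 1 \ {0},
      fderiv ℝ u z Complex.I = J (u z) (fderiv ℝ u z 1) := fun z hz => by
    rw [eq_neg_of_add_eq_zero_left (heq z hz), map_neg, hJsq, neg_neg]
  have hE' : IntegrableOn (fun z => ‖fderiv ℝ u z 1‖ ^ 2) (Metric.ball (0 : ℂ) 1 \ {0}) :=
    Integrable.mono' hE
      ((measurable_fderiv_apply_const ℝ u 1).norm.pow_const 2).aestronglyMeasurable
      (ae_of_all _ fun z => by
        rw [Real.norm_of_nonneg (by positivity)]
        exact le_add_of_nonneg_right (by positivity))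
  obtain ⟨L, hL⟩ := exists_tendsto_of_finite_energy hα.1 hα.2
    (lt_max_of_lt_right one_pos) hB hJ hdiff heq' hE'
  refine ⟨Function.update u 0 L, continuousOn_update_iff.2 ⟨fun z hz =>
    (hdiff z hz).continuousAt.continuousWithinAt, fun _ => hL.mono_left
      (nhdsWithin_mono _ fun z hz => hz.2)⟩, fun z hz => Function.update_of_ne hz.2 _ _⟩
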